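/- arXiv:2503.10826 — 6 statements merged into one kernel-verified Lean document; each statement's English description precedes it below -/
import Mathlib

section
/- Let a, b, k be positive integers with a, b ≥ 2 and gcd(a,b) = 1, and let S = ⟨Geom(a,b;k)⟩ be the numerical semigroup generated by a^k, a^{k-1}b, …, b^k. Then twice the number of gaps of S equals (a−1)·(a^{k−1}b + a^{k−2}b² + ⋯ + b^k) − (a^k − 1); that is, 2·|ℕ \ S| = (a−1)·∑_{i=1}^{k} a^{k−i} b^i − (a^k − 1). -/
/-- The numerical semigroup generated by the geometric sequence
`a^k, a^(k-1)*b, …, b^k`. -/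
def geomNS (a b k : ℕ) : AddSubmonoid ℕ :=
  AddSubmonoid.closure ((fun i => a ^ (k - i) * b ^ i) '' Set.Iic k)

theorem pow_mul_pow_mem_geomNS (a b k i : ℕ) (hi : i ≤ k) :
    a ^ (k - i) * b ^ i ∈ geomNS a b k :=
  AddSubmonoid.subset_closure ⟨i, hi, rfl⟩

theorem mem_geomNS_succ_iff (a b k n : ℕ) :
    n ∈ geomNS a b (k + 1) ↔ ∃ t ∈ geomNS a b k, ∃ i, n = a * t + b ^ (k + 1) * i := by
  constructor
  · intro h
    induction h using AddSubmonoid.closure_induction with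
    | mem x hx =>
      obtain ⟨i, hi, rfl⟩ := hx
      have hi : i ≤ k + 1 := hi
      rcases hi.eq_or_lt with rfl | hlt
      · exact ⟨0, zero_mem _, 1, by simp⟩
      · refine ⟨_, pow_mul_pow_mem_geomNS a b k i (by omega), 0, ?_⟩
        have : k + 1 - i = (k - i) + 1 := by omega
        simp only [this]
        ring
    | zero => exact ⟨0, zero_mem _, 0, by simp⟩
    | add x y _ _ hx hy =>
      obtain ⟨t, ht, i, rfl⟩ := hx
      obtain ⟨u, hu, j, rfl⟩ := hy
      exact ⟨t + u, add_mem ht hu, i + j, by ring⟩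
  · rintro ⟨t, ht, i, rfl⟩
    refine add_mem ?_ ?_
    · induction ht using AddSubmonoid.closure_induction with
      | mem x hx =>
        obtain ⟨i, hi, rfl⟩ := hx
        have hi : i ≤ k := hi
        have h := pow_mul_pow_mem_geomNS a b (k + 1) i (by omega)
        have e : k + 1 - i = (k - i) + 1 := by omega
        rw [e] at h
        convert h using 1
        ring
      | zero => simp
      | add x y _ _ hx hy =>
        rw [mul_add]
        exact add_mem hx hy
    · have h := nsmul_mem (pow_mul_pow_mem_geomNS a b (k + 1) (k + 1) le_rfl) i
      simpa [mul_comm] using h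

/-- Half of the lattice points strictly inside an `a × c` rectangle with coprime sides lie below
the diagonal. -/
theorem two_mul_card_filter_mul_lt_mul {a c : ℕ} (hac : Nat.Coprime a c) :
    2 * ((Finset.Ico 1 a ×ˢ Finset.Ico 1 c).filter fun p => a * p.2 < c * p.1).card =
      (a - 1) * (c - 1) := by
  have hcard : ((Finset.Ico 1 a ×ˢ Finset.Ico 1 c).filter fun p => a * p.2 < c * p.1).card =
      ((Finset.Ico 1 a ×ˢ Finset.Ico 1 c).filter fun p => ¬ a * p.2 < c * p.1).card := by
    refine Finset.card_bij' (fun p _ => (a - p.1, c - p.2)) (fun p _ => (a - p.1, c - p.2))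
      ?_ ?_ ?_ ?_
    · rintro ⟨j, m⟩ h
      simp only [Finset.mem_filter, Finset.mem_product, Finset.mem_Ico] at h ⊢
      refine ⟨by omega, ?_⟩
      rw [Nat.mul_sub, Nat.mul_sub, mul_comm c a]
      omega
    · rintro ⟨j, m⟩ h
      simp only [Finset.mem_filter, Finset.mem_product, Finset.mem_Ico] at h ⊢
      refine ⟨by omega, ?_⟩
      have hne : c * j ≠ a * m := by
        intro e
        have : a ∣ j := hac.dvd_of_dvd_mul_left ⟨m, e⟩
        have := Nat.le_of_dvd (by omega) this
        omega
      have h1 : c * j ≤ c * a := Nat.mul_le_mul_left _ (by omega)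
      have h2 : a * m < a * c := Nat.mul_lt_mul_of_pos_left (by omega) (by omega)
      rw [Nat.mul_sub, Nat.mul_sub, mul_comm c a]
      rw [mul_comm c a] at h1
      omega
    · rintro ⟨j, m⟩ h
      simp only [Finset.mem_filter, Finset.mem_product, Finset.mem_Ico] at h
      ext <;> simp <;> omega
    · rintro ⟨j, m⟩ h
      simp only [Finset.mem_filter, Finset.mem_product, Finset.mem_Ico] at h
      ext <;> simp <;> omega
  have h := Finset.card_filter_add_card_filter_not (s := Finset.Ico 1 a ×ˢ Finset.Ico 1 c)
    (fun p => a * p.2 < c * p.1)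
  rw [Finset.card_product, Nat.card_Ico, Nat.card_Ico] at h
  omega

theorem exists_eq_add_mul_of_mul_modEq {a c i j : ℕ} (hac : Nat.Coprime a c) (hj : j < a)
    (h : c * i ≡ c * j [MOD a]) : ∃ q, i = j + a * q := by
  have h' : i % a = j % a := Nat.ModEq.cancel_left_of_coprime hac h
  rw [Nat.mod_eq_of_lt hj] at h'
  exact ⟨i / a, by rw [← h', Nat.mod_add_div]⟩

/-- The genus of a gluing `a T + c ℕ`, where `c ∈ T` is coprime to `a`. -/
theorem exists_finset_gaps_gluing {a c : ℕ} (ha : 0 < a) (hac : Nat.Coprime a c)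
    {S T : AddSubmonoid ℕ} (hc : c ∈ T) (hS : ∀ n, n ∈ S ↔ ∃ t ∈ T, ∃ i, n = a * t + c * i)
    {G : Finset ℕ} (hG : ∀ n, n ∈ G ↔ n ∉ T) :
    ∃ G' : Finset ℕ, (∀ n, n ∈ G' ↔ n ∉ S) ∧
      2 * G'.card = a * (2 * G.card) + (a - 1) * (c - 1) := by
  set A := (Finset.Ico 1 a ×ˢ Finset.Ico 1 c).filter fun p => a * p.2 < c * p.1 with hA
  have hmemA : ∀ j m, (j, m) ∈ A ↔ ((1 ≤ j ∧ j < a) ∧ 1 ≤ m ∧ m < c) ∧ a * m < c * j := by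
    simp [hA]
  set f : ℕ × ℕ → ℕ := fun p => c * p.1 + a * p.2 with hf
  set g : ℕ × ℕ → ℕ := fun p => c * p.1 - a * p.2 with hg
  have hmod_f : ∀ j m, c * j + a * m ≡ c * j [MOD a] := fun j m => by simp [Nat.ModEq]
  have hmod_g : ∀ j m, a * m ≤ c * j → c * j - a * m ≡ c * j [MOD a] := fun j m h =>
    (Nat.modEq_iff_dvd' (Nat.sub_le _ _)).2 ⟨m, by omega⟩
  have unique : ∀ {i j}, i < a → j < a → c * i ≡ c * j [MOD a] → i = j := by
    intro i j hi hj h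
    exact (Nat.ModEq.cancel_left_of_coprime hac h).eq_of_lt_of_lt hi hj
  have hinj_f : Set.InjOn f (Finset.range a ×ˢ G : Finset (ℕ × ℕ)) := by
    rintro ⟨j, m⟩ h ⟨j', m'⟩ h' e
    simp only [Finset.coe_product, Set.mem_prod, Finset.mem_coe, Finset.mem_range] at h h'
    simp only [hf] at e
    obtain rfl : j = j' := unique h.1 h'.1 ((hmod_f j m).symm.trans (e ▸ hmod_f j' m'))
    have : a * m = a * m' := by omega
    rw [Nat.eq_of_mul_eq_mul_left ha this]
  have hinj_g : Set.InjOn g A := by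
    rintro ⟨j, m⟩ h ⟨j', m'⟩ h' e
    rw [Finset.mem_coe, hmemA] at h h'
    simp only [hg] at e
    obtain rfl : j = j' := unique h.1.1.2 h'.1.1.2
      ((hmod_g j m h.2.le).symm.trans (e ▸ hmod_g j' m' h'.2.le))
    have : a * m = a * m' := by omega
    rw [Nat.eq_of_mul_eq_mul_left ha this]
  have hdisj : Disjoint ((Finset.range a ×ˢ G).image f) (A.image g) := by
    rw [Finset.disjoint_left]
    intro n h h'
    simp only [Finset.mem_image, Prod.exists, Finset.mem_product, Finset.mem_range] at h h'
    obtain ⟨j, m, hjm, e⟩ := h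
    obtain ⟨j', m', hjm', e'⟩ := h'
    rw [hmemA] at hjm'
    simp only [hf, hg] at e e'
    obtain rfl : j = j' := unique hjm.1 hjm'.1.1.2
      ((hmod_f j m).symm.trans (e ▸ e' ▸ hmod_g j' m' hjm'.2.le))
    have : 0 < a * m' := Nat.mul_pos ha hjm'.1.2.1
    omega
  refine ⟨(Finset.range a ×ˢ G).image f ∪ A.image g, fun n => ?_, ?_⟩
  · rw [hS]
    constructor
    · rintro hn ⟨t, ht, i, e⟩
      have hmod : n ≡ c * i [MOD a] := by rw [e, add_comm]; exact hmod_f i t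
      simp only [Finset.mem_union, Finset.mem_image, Prod.exists, Finset.mem_product,
        Finset.mem_range] at hn
      rcases hn with ⟨j, m, ⟨hj, hm⟩, e'⟩ | ⟨j, m, hjm, e'⟩
      · simp only [hf] at e'
        obtain ⟨q, rfl⟩ := exists_eq_add_mul_of_mul_modEq hac hj
          (hmod.symm.trans (e' ▸ hmod_f j m))
        have : a * m = a * (t + c * q) := by
          have : c * (j + a * q) = c * j + a * (c * q) := by ring
          rw [mul_add]
          omega
        rw [hG, Nat.eq_of_mul_eq_mul_left ha this] at hm
        refine hm (add_mem ht ?_)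
        simpa [mul_comm] using nsmul_mem hc q
      · rw [hmemA] at hjm
        simp only [hg] at e'
        obtain ⟨q, rfl⟩ := exists_eq_add_mul_of_mul_modEq hac hjm.1.1.2
          (hmod.symm.trans (e' ▸ hmod_g j m hjm.2.le))
        have : 0 < a * m := Nat.mul_pos ha hjm.1.2.1
        rw [mul_add] at e
        omega
    · intro hn
      obtain ⟨j, hj, hjn⟩ : ∃ j < a, c * j ≡ n [MOD a] := by
        obtain ⟨y, hya, hy⟩ := Nat.exists_mul_mod_eq_of_coprime n hac.symm ha.ne'
        exact ⟨y, hya, hy⟩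
      simp only [Finset.mem_union, Finset.mem_image, Prod.exists, Finset.mem_product,
        Finset.mem_range]
      rcases le_or_gt (c * j) n with h | h
      · obtain ⟨m, hm⟩ := (Nat.modEq_iff_dvd' h).1 hjn
        refine Or.inl ⟨j, m, ⟨hj, (hG m).2 fun hmT => hn ⟨m, hmT, j, by omega⟩⟩, ?_⟩
        simp only [hf]
        omega
      · obtain ⟨m, hm⟩ := (Nat.modEq_iff_dvd' h.le).1 hjn.symm
        have hn0 : 0 < n := by
          rcases Nat.eq_zero_or_pos n with rfl | h0
          · exact absurd ⟨0, zero_mem _, 0, by simp⟩ hn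
          · exact h0
        have hj0 : 0 < j := Nat.pos_of_ne_zero (by rintro rfl; simp at h)
        have hm0 : 0 < m := Nat.pos_of_ne_zero (by rintro rfl; simp at hm; omega)
        have hmc : m < c := by
          refine Nat.lt_of_mul_lt_mul_left (a := a) ?_
          have : c * j ≤ c * a := Nat.mul_le_mul_left _ hj.le
          rw [mul_comm c a] at this
          omega
        refine Or.inr ⟨j, m, (hmemA j m).2 ⟨⟨⟨hj0, hj⟩, hm0, hmc⟩, by omega⟩, ?_⟩
        simp only [hg]
        omega
  · rw [Finset.card_union_of_disjoint hdisj, Finset.card_image_of_injOn hinj_f,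
      Finset.card_image_of_injOn hinj_g, Finset.card_product, Finset.card_range, mul_add,
      two_mul_card_filter_mul_lt_mul hac]
    ring

theorem exists_finset_gaps_geomNS {a b : ℕ} (ha : 0 < a) (hb : 0 < b) (hab : Nat.Coprime a b)
    (k : ℕ) :
    ∃ G : Finset ℕ, (∀ n, n ∈ G ↔ n ∉ geomNS a b k) ∧
      2 * (G.card : ℤ) =
        ((a : ℤ) - 1) * (∑ i ∈ Finset.Icc 1 k, (a : ℤ) ^ (k - i) * (b : ℤ) ^ i)
          - ((a : ℤ) ^ k - 1) := by
  induction k with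
  | zero =>
    refine ⟨∅, fun n => ?_, by simp⟩
    have h := nsmul_mem (pow_mul_pow_mem_geomNS a b 0 0 le_rfl) n
    simp only [Nat.sub_zero, pow_zero, mul_one, smul_eq_mul] at h
    simp [h]
  | succ k ih =>
    obtain ⟨G, hG, hcard⟩ := ih
    have hc : b ^ (k + 1) ∈ geomNS a b k := by
      have h := nsmul_mem (pow_mul_pow_mem_geomNS a b k k le_rfl) b
      simpa [pow_succ'] using h
    obtain ⟨G', hG', hcard'⟩ := exists_finset_gaps_gluing ha (hab.pow_right (k + 1)) hc
      (mem_geomNS_succ_iff a b k) hG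
    refine ⟨G', hG', ?_⟩
    have hsum : ∑ i ∈ Finset.Icc 1 (k + 1), (a : ℤ) ^ (k + 1 - i) * (b : ℤ) ^ i =
        a * (∑ i ∈ Finset.Icc 1 k, (a : ℤ) ^ (k - i) * (b : ℤ) ^ i) + (b : ℤ) ^ (k + 1) := by
      rw [Finset.sum_Icc_succ_top (by omega), Finset.mul_sum]
      congr 1
      · refine Finset.sum_congr rfl fun i hi => ?_
        rw [Nat.succ_sub (Finset.mem_Icc.1 hi).2, pow_succ']
        ring
      · simp
    have hb1 : 1 ≤ b ^ (k + 1) := Nat.one_le_pow _ _ hb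
    zify [hb1, show 1 ≤ a from ha] at hcard'
    rw [hcard', hcard, hsum]
    ring

theorem stmt_0 (a b k : ℕ) (ha : 2 ≤ a) (hb : 2 ≤ b) (hk : 0 < k)
    (hab : Nat.Coprime a b) :
    2 * (Nat.card {n : ℕ // n ∉ geomNS a b k} : ℤ) =
      ((a : ℤ) - 1) * (∑ i ∈ Finset.Icc 1 k, (a : ℤ) ^ (k - i) * (b : ℤ) ^ i)
        - ((a : ℤ) ^ k - 1) := by
  obtain ⟨G, hG, hcard⟩ := exists_finset_gaps_geomNS (by omega : 0 < a) (by omega : 0 < b) hab k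
  rw [← hcard, Nat.subtype_card G hG]
end

section
/- Let a, b, k, m be positive integers with a, b ≥ 2 and gcd(a,b) = 1, let g_i = a^{k−i} b^i for 0 ≤ i ≤ k, and let S = ⟨Geom(a,b;k)⟩. Then the gap set H(S) is equidistributed modulo m if and only if gcd(ab, m) = 1 and, in ℤ[X], the polynomial X^m − 1 divides (X − 1)·∏_{i=1}^{k} (X^{a·g_i} − 1) − ∏_{i=0}^{k} (X^{g_i} − 1). -/
open Polynomial

/-- A set of naturals is equidistributed modulo `m`: every residue class modulo `m`
contains the same number of elements of the set. -/
def EquidistMod (T : Set ℕ) (m : ℕ) : Prop :=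
  ∀ r s : ZMod m,
    Nat.card {n : ℕ // n ∈ T ∧ (n : ZMod m) = r} =
      Nat.card {n : ℕ // n ∈ T ∧ (n : ZMod m) = s}

theorem pow_right_mem_geomNS (a b k : ℕ) : b ^ k ∈ geomNS a b k :=
  AddSubmonoid.subset_closure ⟨k, by simp, by simp⟩

theorem mem_geomNS_succ (a b k n : ℕ) :
    n ∈ geomNS a b (k + 1) ↔ ∃ c, ∃ s ∈ geomNS a b k, n = c * b ^ (k + 1) + a * s := by
  constructor
  · intro h
    induction h using AddSubmonoid.closure_induction with
    | mem x hx =>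
      obtain ⟨i, hi, rfl⟩ := hx
      rw [Set.mem_Iic] at hi
      rcases hi.eq_or_lt with rfl | hi
      · exact ⟨1, 0, zero_mem _, by simp⟩
      · refine ⟨0, a ^ (k - i) * b ^ i, AddSubmonoid.subset_closure ⟨i, ?_, rfl⟩, ?_⟩
        · exact Set.mem_Iic.2 (by lia)
        · simp only [show k + 1 - i = (k - i) + 1 by lia, pow_succ]
          ring
    | zero => exact ⟨0, 0, zero_mem _, by simp⟩
    | add x y _ _ hx hy =>
      obtain ⟨c, s, hs, rfl⟩ := hx
      obtain ⟨d, t, ht, rfl⟩ := hy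
      exact ⟨c + d, s + t, add_mem hs ht, by ring⟩
  · rintro ⟨c, s, hs, rfl⟩
    refine add_mem ?_ ?_
    · rw [← smul_eq_mul]
      exact nsmul_mem (pow_right_mem_geomNS a b (k + 1)) c
    · induction hs using AddSubmonoid.closure_induction with
      | mem x hx =>
        obtain ⟨i, hi, rfl⟩ := hx
        rw [Set.mem_Iic] at hi
        refine AddSubmonoid.subset_closure ⟨i, Set.mem_Iic.2 (by lia), ?_⟩
        simp only [show k + 1 - i = (k - i) + 1 by lia, pow_succ]
        ring
      | zero => simp
      | add x y _ _ hx hy => rw [mul_add]; exact add_mem hx hy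

theorem geomNS_comm (a b k : ℕ) : geomNS a b k = geomNS b a k := by
  have key : ∀ a b : ℕ, geomNS a b k ≤ geomNS b a k := by
    intro a b
    refine AddSubmonoid.closure_le.2 ?_
    rintro _ ⟨i, hi, rfl⟩
    rw [Set.mem_Iic] at hi
    refine AddSubmonoid.subset_closure ⟨k - i, Set.mem_Iic.2 (by lia), ?_⟩
    simp only [show k - (k - i) = i by lia]
    ring
  exact le_antisymm (key a b) (key b a)

theorem finite_gaps_geomNS (a b k : ℕ) (hab : Nat.Coprime a b) :
    {n : ℕ | n ∉ geomNS a b k}.Finite := by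
  obtain ⟨N, hN⟩ := Nat.exists_mem_closure_of_ge ((fun i => a ^ (k - i) * b ^ i) '' Set.Iic k)
  have h1 : Nat.setGcd ((fun i => a ^ (k - i) * b ^ i) '' Set.Iic k) = 1 := by
    refine Nat.dvd_one.1 ?_
    rw [← (hab.pow k k : Nat.gcd (a ^ k) (b ^ k) = 1)]
    exact Nat.dvd_gcd (Nat.setGcd_dvd_of_mem ⟨0, by simp, by simp⟩)
      (Nat.setGcd_dvd_of_mem ⟨k, by simp, by simp⟩)
  refine (Set.finite_Iio N).subset fun n hn => ?_
  by_contra h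
  exact hn (hN n (not_lt.1 h) (h1 ▸ one_dvd n))

/-- The generating polynomial `∑ X ^ n` of the gaps of `⟨Geom(a, b; k)⟩`. -/
noncomputable def geomGapPoly (a b k : ℕ) (hab : Nat.Coprime a b) : ℤ[X] :=
  ∑ n ∈ (finite_gaps_geomNS a b k hab).toFinset, X ^ n

open Classical in
theorem coeff_geomGapPoly (a b k : ℕ) (hab : Nat.Coprime a b) (n : ℕ) :
    (geomGapPoly a b k hab).coeff n = if n ∈ geomNS a b k then 0 else 1 := by
  rw [geomGapPoly, finsetSum_coeff]
  simp [coeff_X_pow]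

theorem mem_geomNS_succ_of_not_dvd {a b k n : ℕ} (hn : ¬ a ∣ n) :
    n ∈ geomNS a b (k + 1) ↔ b ^ (k + 1) ≤ n ∧ n - b ^ (k + 1) ∈ geomNS a b (k + 1) := by
  constructor
  · intro h
    obtain ⟨c, s, hs, rfl⟩ := (mem_geomNS_succ a b k n).1 h
    obtain _ | c := c
    · exact absurd ⟨s, by simp⟩ hn
    · have : (c + 1) * b ^ (k + 1) = c * b ^ (k + 1) + b ^ (k + 1) := by ring
      refine ⟨by lia, (mem_geomNS_succ a b k _).2 ⟨c, s, hs, by lia⟩⟩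
  · rintro ⟨h1, h2⟩
    have := add_mem h2 (pow_right_mem_geomNS a b (k + 1))
    rwa [Nat.sub_add_cancel h1] at this

theorem mul_mem_geomNS_succ {a b k s : ℕ} (ha : 0 < a) (hab : Nat.Coprime a b) :
    a * s ∈ geomNS a b (k + 1) ↔ s ∈ geomNS a b k := by
  constructor
  · intro h
    obtain ⟨c, t, ht, h⟩ := (mem_geomNS_succ a b k _).1 h
    have hd : a ∣ c * b ^ (k + 1) := (Nat.dvd_add_left (Dvd.intro t rfl)).1 (h ▸ Dvd.intro s rfl)
    obtain ⟨d, rfl⟩ := (hab.pow_right (k + 1)).dvd_of_dvd_mul_right hd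
    have : s = (d * b) * b ^ k + t := by
      refine Nat.eq_of_mul_eq_mul_left ha ?_
      rw [h]; ring
    rw [this, ← smul_eq_mul (d * b)]
    exact add_mem (nsmul_mem (pow_right_mem_geomNS a b k) _) ht
  · exact fun h => (mem_geomNS_succ a b k _).2 ⟨0, s, h, by simp⟩

theorem mul_sub_mem_geomNS_succ {a b k s : ℕ} (ha : 0 < a) (hab : Nat.Coprime a b) :
    (b ^ (k + 1) ≤ a * s ∧ a * s - b ^ (k + 1) ∈ geomNS a b (k + 1)) ↔
      (b ^ (k + 1) ≤ s ∧ s - b ^ (k + 1) ∈ geomNS a b k) := by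
  constructor
  · rintro ⟨h1, h⟩
    obtain ⟨c, t, ht, h⟩ := (mem_geomNS_succ a b k _).1 h
    have h' : a * s = (c + 1) * b ^ (k + 1) + a * t := by
      have : (c + 1) * b ^ (k + 1) = c * b ^ (k + 1) + b ^ (k + 1) := by ring
      lia
    have hd : a ∣ (c + 1) * b ^ (k + 1) :=
      (Nat.dvd_add_left (Dvd.intro t rfl)).1 (h' ▸ Dvd.intro s rfl)
    obtain ⟨d, hd⟩ := (hab.pow_right (k + 1)).dvd_of_dvd_mul_right hd
    obtain _ | d := d
    · simp at hd
    rw [hd] at h'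
    have : s = (d * b) * b ^ k + t + b ^ (k + 1) := by
      refine Nat.eq_of_mul_eq_mul_left ha ?_
      rw [h']; ring
    refine ⟨by lia, ?_⟩
    rw [this, Nat.add_sub_cancel, ← smul_eq_mul (d * b)]
    exact add_mem (nsmul_mem (pow_right_mem_geomNS a b k) _) ht
  · rintro ⟨h1, h⟩
    obtain ⟨t, rfl⟩ := Nat.exists_eq_add_of_le h1
    rw [Nat.add_sub_cancel_left] at h
    obtain ⟨d, rfl⟩ := Nat.exists_eq_add_of_lt ha
    have : (0 + d + 1) * (b ^ (k + 1) + t) =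
      b ^ (k + 1) + (d * b ^ (k + 1) + (0 + d + 1) * t) := by ring
    rw [this, Nat.add_sub_cancel_left]
    exact ⟨by lia, (mem_geomNS_succ _ b k _).2 ⟨d, t, h, rfl⟩⟩

open PowerSeries in
open Classical in
theorem geomNS_succ_series (a b k : ℕ) (ha : 0 < a) (hab : Nat.Coprime a b) :
    (1 - (PowerSeries.X : ℤ⟦X⟧) ^ b ^ (k + 1)) *
        PowerSeries.mk (fun n => if n ∈ geomNS a b (k + 1) then (1 : ℤ) else 0) =
      (1 - PowerSeries.X ^ (a * b ^ (k + 1))) *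
        PowerSeries.mk (fun n => if a ∣ n ∧ n / a ∈ geomNS a b k then (1 : ℤ) else 0) := by
  ext n
  simp only [sub_mul, one_mul, map_sub, PowerSeries.coeff_X_pow_mul', PowerSeries.coeff_mk]
  by_cases hn : a ∣ n
  · obtain ⟨s, rfl⟩ := hn
    have h1 := mul_mem_geomNS_succ (k := k) (s := s) ha hab
    have h2 := mul_sub_mem_geomNS_succ (k := k) (s := s) ha hab
    simp only [← ite_and, h1, h2, Nat.mul_le_mul_left_iff ha, ← Nat.mul_sub, dvd_mul_right,
      true_and, Nat.mul_div_cancel_left _ ha]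
  · have h1 := mem_geomNS_succ_of_not_dvd (b := b) (k := k) hn
    have h2 : ¬ (a * b ^ (k + 1) ≤ n ∧ (a ∣ n - a * b ^ (k + 1) ∧
        (n - a * b ^ (k + 1)) / a ∈ geomNS a b k)) := by
      rintro ⟨h, h', -⟩
      exact hn ((Nat.dvd_sub_iff_left h (Dvd.intro _ rfl)).1 h')
    simp only [← ite_and, ← h1, h2, hn, false_and, if_false, sub_self]

theorem geomGapPoly_succ (a b k : ℕ) (ha : 0 < a) (hab : Nat.Coprime a b) :
    (X ^ b ^ (k + 1) - 1) * (1 + (X - 1) * geomGapPoly a b (k + 1) hab) * (X ^ a - 1) =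
      (X ^ (a * b ^ (k + 1)) - 1) * (X - 1) *
        (1 + (X ^ a - 1) * expand ℤ a (geomGapPoly a b k hab)) := by
  classical
  have hU : (1 - (PowerSeries.X : PowerSeries ℤ)) * PowerSeries.mk (fun _ => (1 : ℤ)) = 1 := by
    rw [mul_comm]; exact PowerSeries.mk_one_mul_one_sub_eq_one ℤ
  have hV : (1 - (PowerSeries.X : PowerSeries ℤ) ^ a) *
      PowerSeries.mk (fun n => if a ∣ n then (1 : ℤ) else 0) = 1 := by
    ext n
    simp only [sub_mul, one_mul, map_sub, PowerSeries.coeff_X_pow_mul', PowerSeries.coeff_mk,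
      PowerSeries.coeff_one]
    rcases Nat.eq_zero_or_pos n with rfl | hn
    · simp [ha.ne']
    · by_cases h : a ≤ n
      · simp [h, hn.ne', Nat.dvd_sub_iff_left h dvd_rfl]
      · have h' : ¬ a ∣ n := fun h' => h (Nat.le_of_dvd hn h')
        simp [h, hn.ne', h']
  have hH : PowerSeries.mk (fun n => if n ∈ geomNS a b (k + 1) then (1 : ℤ) else 0) =
      PowerSeries.mk (fun _ => (1 : ℤ)) - (geomGapPoly a b (k + 1) hab : PowerSeries ℤ) := by
    ext n
    simp only [map_sub, PowerSeries.coeff_mk, coeff_coe, coeff_geomGapPoly]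
    split_ifs <;> simp
  have hH' : PowerSeries.mk (fun n => if a ∣ n ∧ n / a ∈ geomNS a b k then (1 : ℤ) else 0) =
      PowerSeries.mk (fun n => if a ∣ n then (1 : ℤ) else 0) -
        (expand ℤ a (geomGapPoly a b k hab) : ℤ[X]) := by
    ext n
    simp only [map_sub, PowerSeries.coeff_mk, coeff_coe, coeff_geomGapPoly, coeff_expand ha]
    by_cases h : a ∣ n <;> by_cases h' : n / a ∈ geomNS a b k <;> simp [h, h']
  have key := geomNS_succ_series a b k ha hab
  rw [hH, hH'] at key
  apply Polynomial.coe_injective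
  push_cast
  linear_combination ((1 - PowerSeries.X) * (1 - PowerSeries.X ^ a)) * key -
    ((1 - PowerSeries.X ^ b ^ (k + 1)) * (1 - PowerSeries.X ^ a)) * hU +
    ((1 - PowerSeries.X ^ (a * b ^ (k + 1))) * (1 - PowerSeries.X)) * hV

theorem geomGapPoly_zero (a b : ℕ) (hab : Nat.Coprime a b) : geomGapPoly a b 0 hab = 0 := by
  classical
  ext n
  have : n ∈ geomNS a b 0 := by
    have := nsmul_mem (pow_right_mem_geomNS a b 0) n
    simpa using this
  rw [coeff_geomGapPoly, if_pos this, coeff_zero]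

theorem X_pow_sub_one_ne_zero {n : ℕ} (hn : 0 < n) : (X ^ n - 1 : ℤ[X]) ≠ 0 :=
  (monic_X_pow_sub_C (1 : ℤ) hn.ne').ne_zero

theorem prod_mul_one_add_geomGapPoly (a b k : ℕ) (ha : 0 < a) (hab : Nat.Coprime a b) :
    (∏ i ∈ Finset.range (k + 1), (X ^ (a ^ (k - i) * b ^ i) - 1)) *
        (1 + (X - 1) * geomGapPoly a b k hab) =
      (X - 1) * ∏ i ∈ Finset.Icc 1 k, (X ^ (a * (a ^ (k - i) * b ^ i)) - 1) := by
  induction k with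
  | zero => simp [geomGapPoly_zero]
  | succ k ih =>
    have h1 : ∏ i ∈ Finset.range (k + 1), ((X : ℤ[X]) ^ (a ^ (k + 1 - i) * b ^ i) - 1) =
        expand ℤ a (∏ i ∈ Finset.range (k + 1), (X ^ (a ^ (k - i) * b ^ i) - 1)) := by
      rw [map_prod]
      refine Finset.prod_congr rfl fun i hi => ?_
      rw [Finset.mem_range] at hi
      simp only [map_sub, map_pow, expand_X, map_one, ← pow_mul,
        show k + 1 - i = (k - i) + 1 by lia, pow_succ]
      ring
    have h2 : ∏ i ∈ Finset.Icc 1 k, ((X : ℤ[X]) ^ (a * (a ^ (k + 1 - i) * b ^ i)) - 1) =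
        expand ℤ a (∏ i ∈ Finset.Icc 1 k, (X ^ (a * (a ^ (k - i) * b ^ i)) - 1)) := by
      rw [map_prod]
      refine Finset.prod_congr rfl fun i hi => ?_
      rw [Finset.mem_Icc] at hi
      simp only [map_sub, map_pow, expand_X, map_one, ← pow_mul,
        show k + 1 - i = (k - i) + 1 by lia, pow_succ]
      ring
    rw [Finset.prod_range_succ, ← Finset.insert_Icc_right_eq_Icc_add_one (by lia),
      Finset.prod_insert (by simp), h1, h2]
    have ih' := congrArg (expand ℤ a) ih
    simp only [map_mul, map_add, map_one, map_sub, expand_X] at ih'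
    have step := geomGapPoly_succ a b k ha hab
    refine mul_right_cancel₀ (X_pow_sub_one_ne_zero ha) ?_
    simp only [Nat.sub_self, pow_zero, one_mul]
    simp only [map_prod, map_sub, map_one] at ih' step ⊢
    linear_combination (∏ i ∈ Finset.range (k + 1),
      (expand ℤ a (X ^ (a ^ (k - i) * b ^ i)) - 1)) * step +
      (X ^ (a * b ^ (k + 1)) - 1) * (X - 1) * ih'

section ModX

variable {m : ℕ}

/-- Reduction of integer polynomials modulo `X ^ m - 1`, valued in the group ring of `ZMod m`. -/
noncomputable def cyclicReduction (m : ℕ) : ℤ[X] →ₐ[ℤ] AddMonoidAlgebra ℤ (ZMod m) :=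
  aeval (AddMonoidAlgebra.single 1 1)

theorem cyclicReduction_X_pow (n : ℕ) :
    cyclicReduction m (X ^ n) = AddMonoidAlgebra.single (n : ZMod m) 1 := by
  simp [cyclicReduction, AddMonoidAlgebra.single_pow]

theorem cyclicReduction_eq_zero_iff (hm : 0 < m) (p : ℤ[X]) :
    cyclicReduction m p = 0 ↔ X ^ m - 1 ∣ p := by
  have hmon : (X ^ m - 1 : ℤ[X]).Monic := monic_X_pow_sub_C 1 hm.ne'
  have h0 : cyclicReduction m (X ^ m - 1) = 0 := by
    rw [map_sub, cyclicReduction_X_pow, map_one, ZMod.natCast_self]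
    exact sub_self _
  constructor
  · intro h
    have h1 : cyclicReduction m (p %ₘ (X ^ m - 1)) = 0 := by
      have := congrArg (cyclicReduction m) (modByMonic_add_div p (X ^ m - 1))
      rwa [map_add, map_mul, h0, zero_mul, add_zero, h] at this
    rw [← modByMonic_eq_zero_iff_dvd hmon]
    have hdeg : (p %ₘ (X ^ m - 1)).natDegree < m := by
      have := natDegree_modByMonic_lt p hmon (by
        intro h
        have := congrArg natDegree h
        rw [natDegree_one, ← C_1, natDegree_X_pow_sub_C] at this
        lia)
      rwa [← C_1, natDegree_X_pow_sub_C] at this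
    generalize p %ₘ (X ^ m - 1) = q at *
    ext i
    rw [coeff_zero]
    by_cases hi : i < m
    · rw [q.as_sum_range_C_mul_X_pow' hdeg, map_sum] at h1
      have h2 := congrArg (fun x : AddMonoidAlgebra ℤ (ZMod m) => x.coeff (i : ZMod m)) h1
      simp only [C_mul', map_smul, cyclicReduction_X_pow] at h2
      simp only [AddMonoidAlgebra.coeff_sum, AddMonoidAlgebra.coeff_smul, Finsupp.coe_finsetSum,
        Finset.sum_apply, Finsupp.smul_apply, AddMonoidAlgebra.coeff_single, AddMonoidAlgebra.coeff_zero,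
        Finsupp.coe_zero, Pi.zero_apply] at h2
      rw [Finset.sum_eq_single_of_mem i (Finset.mem_range.2 hi)] at h2
      · simpa using h2
      · intro j hj hji
        rw [Finset.mem_range] at hj
        rw [Finsupp.single_eq_of_ne, smul_zero]
        intro h
        rw [ZMod.natCast_eq_natCast_iff', Nat.mod_eq_of_lt hi, Nat.mod_eq_of_lt hj] at h
        exact hji h.symm
    · exact coeff_eq_zero_of_natDegree_lt (by lia)
  · rintro ⟨q, rfl⟩
    rw [map_mul, h0, zero_mul]

theorem coeff_cyclicReduction_sum (G : Finset ℕ) (r : ZMod m) :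
    (cyclicReduction m (∑ n ∈ G, X ^ n)).coeff r = (G.filter fun n : ℕ => (n : ZMod m) = r).card := by
  rw [map_sum, Finset.card_filter]
  simp [cyclicReduction_X_pow, Finsupp.single_apply]

theorem equidistMod_iff_dvd (hm : 0 < m) {T : Set ℕ} (hT : T.Finite) :
    EquidistMod T m ↔ (X ^ m - 1 : ℤ[X]) ∣ (X - 1) * ∑ n ∈ hT.toFinset, X ^ n := by
  have : NeZero m := ⟨hm.ne'⟩
  have hcard : ∀ r : ZMod m, (Nat.card {n : ℕ // n ∈ T ∧ (n : ZMod m) = r} : ℤ) =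
      (cyclicReduction m (∑ n ∈ hT.toFinset, X ^ n)).coeff r := by
    intro r
    rw [coeff_cyclicReduction_sum, Nat.subtype_card]
    simp
  rw [← cyclicReduction_eq_zero_iff hm, sub_mul, one_mul, map_sub, sub_eq_zero, map_mul,
    ← pow_one X, cyclicReduction_X_pow, Nat.cast_one]
  simp only [pow_one]
  have hshift : ∀ r : ZMod m, ((AddMonoidAlgebra.single (1 : ZMod m) (1 : ℤ) *
      cyclicReduction m (∑ n ∈ hT.toFinset, X ^ n)).coeff r : ℤ) =
      Nat.card {n : ℕ // n ∈ T ∧ (n : ZMod m) = r - 1} := by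
    intro r
    rw [hcard, AddMonoidAlgebra.coeff_single_mul_apply, one_mul, neg_add_eq_sub]
  constructor
  · intro h
    ext r
    rw [hshift, ← hcard, h (r - 1) r]
  · intro h
    have hstep : ∀ r : ZMod m, Nat.card {n : ℕ // n ∈ T ∧ (n : ZMod m) = r - 1} =
        Nat.card {n : ℕ // n ∈ T ∧ (n : ZMod m) = r} := by
      intro r
      have := hshift r
      rw [h, ← hcard] at this
      exact_mod_cast this.symm
    have hzero : ∀ j : ℕ, Nat.card {n : ℕ // n ∈ T ∧ (n : ZMod m) = j} =
        Nat.card {n : ℕ // n ∈ T ∧ (n : ZMod m) = 0} := by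
      intro j
      induction j with
      | zero => simp
      | succ j ih => rw [← ih, ← hstep ((j + 1 : ℕ) : ZMod m)]; simp
    intro r s
    rw [← ZMod.natCast_zmod_val r, ← ZMod.natCast_zmod_val s, hzero, hzero]

theorem X_pow_sub_one_dvd_of_dvd_sub_one_mul (hm : 0 < m) {p : ℤ[X]}
    (h : X ^ m - 1 ∣ (X - 1) * ((X - 1) * p)) : X ^ m - 1 ∣ (X - 1) * p := by
  have hX : (X - 1 : ℤ[X]) ≠ 0 := by simpa using X_pow_sub_one_ne_zero one_pos
  rw [← mul_geom_sum] at h ⊢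
  obtain ⟨q, hq⟩ := h
  rw [mul_assoc] at hq
  have hq := mul_left_cancel₀ hX hq
  have h1 := congrArg (eval 1) hq
  simp [eval_finsetSum, hm.ne'] at h1
  obtain ⟨r, rfl⟩ : X - 1 ∣ q := by
    rw [← C_1]; exact dvd_iff_isRoot.2 (by simpa using h1)
  refine mul_dvd_mul_left _ ⟨r, mul_left_cancel₀ hX ?_⟩
  rw [hq]; ring

theorem X_pow_sub_one_dvd_of_coprime (hm : 0 < m) {g : ℕ} (hg : Nat.Coprime g m) {p : ℤ[X]}
    (h : X ^ m - 1 ∣ (X ^ g - 1) * ((X - 1) * p)) : X ^ m - 1 ∣ (X - 1) * p := by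
  refine X_pow_sub_one_dvd_of_dvd_sub_one_mul hm ?_
  obtain ⟨u, hu⟩ : ∃ u : ℕ, ((g * u : ℕ) : ZMod m) = (1 : ℕ) := by
    have : NeZero m := ⟨hm.ne'⟩
    refine ⟨((g : ZMod m)⁻¹).val, ?_⟩
    push_cast
    rw [ZMod.natCast_zmod_val, ZMod.coe_mul_inv_eq_one _ hg]
  have h1 : X ^ m - 1 ∣ (X ^ (g * u) - 1 : ℤ[X]) * ((X - 1) * p) := by
    refine h.trans (mul_dvd_mul_right ?_ _)
    rw [pow_mul]
    exact sub_one_dvd_pow_sub_one _ _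
  have h2 : (X ^ m - 1 : ℤ[X]) ∣ X ^ (g * u) - X := by
    rw [← cyclicReduction_eq_zero_iff hm, map_sub, ← pow_one X, ← pow_mul,
      cyclicReduction_X_pow, cyclicReduction_X_pow, one_mul, hu, sub_self]
  have h3 := dvd_sub h1 (h2.mul_right ((X - 1) * p))
  rwa [← sub_mul, sub_sub_sub_cancel_left] at h3

theorem X_pow_sub_one_dvd_of_prod (hm : 0 < m) {ι : Type*} (I : Finset ι) (g : ι → ℕ)
    (hg : ∀ i ∈ I, Nat.Coprime (g i) m) {p : ℤ[X]}
    (h : X ^ m - 1 ∣ (∏ i ∈ I, (X ^ g i - 1)) * ((X - 1) * p)) : X ^ m - 1 ∣ (X - 1) * p := by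
  classical
  induction I using Finset.induction_on with
  | empty => simpa using h
  | insert i I hi ih =>
    refine ih (fun j hj => hg j (Finset.mem_insert_of_mem hj)) ?_
    rw [mul_left_comm]
    refine X_pow_sub_one_dvd_of_coprime hm (hg i (Finset.mem_insert_self i I)) ?_
    rw [Finset.prod_insert hi] at h
    convert h using 1
    ring

end ModX

theorem Complex.eq_one_of_geom_sum_eq {z : ℂ} (hz : ‖z‖ = 1) {n : ℕ} (hn : 2 ≤ n)
    (h : ∑ i ∈ Finset.range n, z ^ i = n) : z = 1 := by
  obtain ⟨n, rfl⟩ := Nat.exists_eq_add_of_le' hn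
  have hre : ∀ w : ℂ, ‖w‖ = 1 → w.re ≤ 1 := fun w hw => hw ▸ w.re_le_norm
  have h1 := congrArg Complex.re h
  rw [Finset.sum_range_succ', Finset.sum_range_succ'] at h1
  have h2 : (∑ i ∈ Finset.range n, z ^ (i + 1 + 1)).re ≤ n := by
    rw [Complex.re_sum]
    refine (Finset.sum_le_card_nsmul _ _ 1 fun i _ => hre _ (by simp [hz])).trans ?_
    simp
  have h3 : z.re = 1 := by
    refine le_antisymm (hre z hz) ?_
    simp at h1 h2
    linarith
  have h4 : z.im = 0 := by
    have := Complex.sq_norm z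
    rw [hz, Complex.normSq_apply, h3] at this
    nlinarith
  exact Complex.ext h3 h4

theorem coprime_of_dvd_geomGapPoly (a b k m : ℕ) (ha : 2 ≤ a) (hb : 2 ≤ b) (hk : 0 < k)
    (hab : Nat.Coprime a b) (hm : 0 < m)
    (h : (X ^ m - 1 : ℤ[X]) ∣ (X - 1) * geomGapPoly a b k hab) : Nat.Coprime a m := by
  obtain ⟨k, rfl⟩ := Nat.exists_eq_add_of_lt hk
  rw [zero_add] at h
  by_contra hd
  have hd0 : Nat.gcd a m ≠ 0 := (Nat.gcd_pos_of_pos_right a hm).ne'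
  have hζ := Complex.isPrimitiveRoot_exp _ hd0
  set z := Complex.exp (2 * Real.pi * Complex.I / (Nat.gcd a m : ℕ))
  have hza : z ^ a = 1 := (hζ.pow_eq_one_iff_dvd a).2 (Nat.gcd_dvd_left a m)
  have hzm : z ^ m = 1 := (hζ.pow_eq_one_iff_dvd m).2 (Nat.gcd_dvd_right a m)
  have hE : (∑ i ∈ Finset.range (b ^ (k + 1)), X ^ i) *
      (1 + (X - 1) * geomGapPoly a b (k + 1) hab) =
      (∑ i ∈ Finset.range (b ^ (k + 1)), (X ^ a) ^ i) *
      (1 + (X ^ a - 1) * expand ℤ a (geomGapPoly a b k hab)) := by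
    have step := geomGapPoly_succ a b k (by lia) hab
    rw [pow_mul, ← mul_geom_sum X (b ^ (k + 1)), ← mul_geom_sum (X ^ a)] at step
    have hX : (X - 1 : ℤ[X]) ≠ 0 := by simpa using X_pow_sub_one_ne_zero one_pos
    refine mul_left_cancel₀ (mul_ne_zero hX (X_pow_sub_one_ne_zero (show 0 < a by lia))) ?_
    linear_combination step
  have h0 : aeval z ((X - 1) * geomGapPoly a b (k + 1) hab) = 0 := by
    obtain ⟨q, hq⟩ := h
    rw [hq]
    simp [hzm]
  have hval := congrArg (aeval z) hE
  rw [map_mul, map_add, h0] at hval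
  simp [hza] at hval
  have hz : z = 1 := by
    refine Complex.eq_one_of_geom_sum_eq (hζ.norm'_eq_one hd0) (n := b ^ (k + 1))
      (hb.trans (Nat.le_self_pow (by lia) b)) ?_
    rw [hval]
    push_cast
    rfl
  exact hd (Nat.dvd_one.1 ((hζ.pow_eq_one_iff_dvd 1).1 (by rw [hz, one_pow])))

theorem stmt_1 (a b k m : ℕ) (ha : 2 ≤ a) (hb : 2 ≤ b) (hk : 0 < k) (hm : 0 < m)
    (hab : Nat.Coprime a b) :
    EquidistMod {n : ℕ | n ∉ geomNS a b k} m ↔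
      Nat.Coprime (a * b) m ∧
        ((X : ℤ[X]) ^ m - 1) ∣
          ((X - 1) * ∏ i ∈ Finset.Icc 1 k, (X ^ (a * (a ^ (k - i) * b ^ i)) - 1)
            - ∏ i ∈ Finset.range (k + 1), (X ^ (a ^ (k - i) * b ^ i) - 1)) := by
  rw [← prod_mul_one_add_geomGapPoly a b k (by lia) hab, mul_add, mul_one, add_sub_cancel_left]
  have hequi := equidistMod_iff_dvd hm (finite_gaps_geomNS a b k hab)
  change EquidistMod _ m ↔ _ ∣ (X - 1) * geomGapPoly a b k hab at hequi
  constructor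
  · intro h
    have hdvd := hequi.1 h
    refine ⟨Nat.Coprime.mul_left (coprime_of_dvd_geomGapPoly a b k m ha hb hk hab hm hdvd) ?_,
      hdvd.mul_left _⟩
    rw [geomNS_comm] at h
    exact coprime_of_dvd_geomGapPoly b a k m hb ha hk hab.symm hm
      ((equidistMod_iff_dvd hm (finite_gaps_geomNS b a k hab.symm)).1 h)
  · rintro ⟨hc, h⟩
    refine hequi.2 (X_pow_sub_one_dvd_of_prod hm _ _ (fun i _ => ?_) h)
    exact Nat.Coprime.mul_left (hc.coprime_mul_right.pow_left _)
      (hc.coprime_mul_left.pow_left _)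
end

section
/- Let a, b be integers with a, b ≥ 2 and gcd(a,b) = 1, let S = ⟨a², ab, b²⟩ be the numerical semigroup generated by a², ab, b², and let m be a positive integer. Then the gap set H(S) is equidistributed modulo m if and only if gcd(ab, m) = 1 and at least one of the following holds: a ≡ 1 (mod m); b ≡ 1 (mod m); or a³ ≡ 1, b³ ≡ 1 and ab ≡ 1 (mod m). -/
theorem mem_closure_iff_normalForm {a b : ℕ} (hb : 0 < b) (n : ℕ) :
    n ∈ AddSubmonoid.closure {a ^ 2, a * b, b ^ 2} ↔
      ∃ i < b, ∃ j < b, ∃ k, n = a ^ 2 * i + a * b * j + b ^ 2 * k := by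
  constructor
  · intro h
    suffices H : ∃ x y z, n = a ^ 2 * x + a * b * y + b ^ 2 * z by
      obtain ⟨x, y, z, rfl⟩ := H
      refine ⟨x % b, Nat.mod_lt _ hb, (y + a * (x / b)) % b, Nat.mod_lt _ hb,
        z + a * ((y + a * (x / b)) / b), ?_⟩
      have h1 := Nat.mod_add_div x b
      have h2 := Nat.mod_add_div (y + a * (x / b)) b
      linear_combination a ^ 2 * h1.symm + a * b * h2.symm
    induction h using AddSubmonoid.closure_induction with
    | mem x hx =>
      rcases hx with rfl | rfl | rfl
      · exact ⟨1, 0, 0, by simp⟩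
      · exact ⟨0, 1, 0, by simp⟩
      · exact ⟨0, 0, 1, by simp⟩
    | zero => exact ⟨0, 0, 0, by simp⟩
    | add u v _ _ hu hv =>
      obtain ⟨x, y, z, rfl⟩ := hu
      obtain ⟨x', y', z', rfl⟩ := hv
      exact ⟨x + x', y + y', z + z', by ring⟩
  · rintro ⟨i, -, j, -, k, rfl⟩
    have key : ∀ g ∈ ({a ^ 2, a * b, b ^ 2} : Set ℕ), ∀ t,
        g * t ∈ AddSubmonoid.closure ({a ^ 2, a * b, b ^ 2} : Set ℕ) := fun g hg t => by
      have := nsmul_mem (AddSubmonoid.subset_closure hg) t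
      rwa [smul_eq_mul, mul_comm t g] at this
    exact add_mem (add_mem (key _ (by simp) _) (key _ (by simp) _)) (key _ (by simp) _)

theorem normalForm_unique {a b i j k i' j' k' : ℕ} (hab : Nat.Coprime a b)
    (hi : i < b) (hj : j < b) (hi' : i' < b) (hj' : j' < b)
    (h : a ^ 2 * i + a * b * j + b ^ 2 * k = a ^ 2 * i' + a * b * j' + b ^ 2 * k') :
    i = i' ∧ j = j' ∧ k = k' := by
  have hb : 0 < b := by omega
  have h1 : i = i' := by
    have : a ^ 2 * i ≡ a ^ 2 * i' [MOD b] := by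
      have e : a ^ 2 * i + b * (a * j + b * k) = a ^ 2 * i' + b * (a * j' + b * k') := by
        linear_combination h
      have := congrArg (· % b) e
      simpa [Nat.ModEq] using this
    exact (Nat.ModEq.cancel_left_of_coprime (hab.symm.pow_right 2) this).eq_of_lt_of_lt hi hi'
  subst h1
  have e : a * j + b * k = a * j' + b * k' :=
    Nat.eq_of_mul_eq_mul_left hb (by linear_combination h)
  have h2 : j = j' := by
    have : a * j ≡ a * j' [MOD b] := by
      have := congrArg (· % b) e
      simpa [Nat.ModEq] using this
    exact (Nat.ModEq.cancel_left_of_coprime hab.symm this).eq_of_lt_of_lt hj hj'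
  subst h2
  exact ⟨rfl, rfl, Nat.eq_of_mul_eq_mul_left hb (by linarith)⟩

theorem sum_gaps_add_sum_apery {A : Type*} [AddCommMonoid A] (S : AddSubmonoid ℕ)
    {G P : Finset ℕ} {d : ℕ} (hd : d ∈ S) (hG : ∀ n, n ∈ G ↔ n ∉ S)
    (hP : ∀ n, n ∈ P ↔ n ∈ S ∧ ∀ k ∈ S, n ≠ k + d) (F : ℕ → A) :
    ∑ n ∈ G, F n + ∑ n ∈ P, F n = ∑ n ∈ Finset.range d, F n + ∑ n ∈ G, F (n + d) := by
  rw [← Finset.sum_union (Finset.disjoint_left.2 fun n h h' => (hG n).1 h ((hP n).1 h').1),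
    show ∑ n ∈ G, F (n + d) = ∑ n ∈ G.map (addRightEmbedding d), F n by simp,
    ← Finset.sum_union]
  · congr 1
    ext n
    simp only [Finset.mem_union, hG, hP, Finset.mem_range, Finset.mem_map, addRightEmbedding_apply]
    by_cases hn : n < d
    · simp only [hn, true_or, iff_true]
      by_cases h : n ∈ S
      · exact Or.inr ⟨h, fun k _ => by omega⟩
      · exact Or.inl h
    · obtain ⟨k, rfl⟩ := Nat.exists_eq_add_of_le' (not_lt.1 hn)
      simp only [hn, false_or, add_left_inj, exists_eq_right, ne_eq]
      by_cases h : k ∈ S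
      · simp only [h, S.add_mem h hd, not_true_eq_false, true_and, false_or, iff_false]
        exact fun H => H k h rfl
      · simp only [h, not_false_eq_true, iff_true]
        by_cases h' : k + d ∈ S
        · exact Or.inr ⟨h', by rintro _ hk rfl; exact h hk⟩
        · exact Or.inl h'
  · rw [Finset.disjoint_left]
    intro n hn hn'
    simp only [Finset.mem_range, Finset.mem_map, addRightEmbedding_apply] at hn hn'
    omega

theorem sum_gaps_add_sum_normalForm {A : Type*} [AddCommMonoid A] {a b : ℕ} (hb : 0 < b)
    (hab : Nat.Coprime a b) {G : Finset ℕ}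
    (hG : ∀ n, n ∈ G ↔ n ∉ AddSubmonoid.closure {a ^ 2, a * b, b ^ 2}) (F : ℕ → A) :
    ∑ n ∈ G, F n + ∑ i ∈ Finset.range b, ∑ j ∈ Finset.range b, F (a ^ 2 * i + a * b * j) =
      ∑ n ∈ Finset.range (b ^ 2), F n + ∑ n ∈ G, F (n + b ^ 2) := by
  rw [← Finset.sum_product', ← sum_gaps_add_sum_apery _ (AddSubmonoid.subset_closure (by simp)) hG
    (P := (Finset.range b ×ˢ Finset.range b).image fun p => a ^ 2 * p.1 + a * b * p.2),
    Finset.sum_image]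
  · rintro ⟨i, j⟩ h ⟨i', j'⟩ h' e
    simp only [Finset.coe_product, Finset.coe_range, Set.mem_prod, Set.mem_Iio] at h h'
    obtain ⟨rfl, rfl, -⟩ := normalForm_unique (k := 0) (k' := 0) hab h.1 h.2 h'.1 h'.2 (by simpa)
    rfl
  · intro n
    simp only [Finset.mem_image, Finset.mem_product, Finset.mem_range, Prod.exists,
      mem_closure_iff_normalForm hb]
    constructor
    · rintro ⟨i, j, ⟨hi, hj⟩, rfl⟩
      refine ⟨⟨i, hi, j, hj, 0, by simp⟩, ?_⟩
      rintro _ ⟨i', hi', j', hj', k, rfl⟩ e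
      obtain ⟨-, -, h⟩ := normalForm_unique (k := 0) (k' := k + 1) hab hi hj hi' hj'
        (by linear_combination e)
      omega
    · rintro ⟨⟨i, hi, j, hj, k, rfl⟩, h⟩
      cases k with
      | zero => exact ⟨i, j, ⟨hi, hj⟩, by simp⟩
      | succ k => exact absurd (by ring) (h _ ⟨i, hi, j, hj, k, rfl⟩)

theorem finite_gaps {a b : ℕ} (ha : 2 ≤ a) (hb : 2 ≤ b) (hab : Nat.Coprime a b) :
    {n : ℕ | n ∉ AddSubmonoid.closure {a ^ 2, a * b, b ^ 2}}.Finite := by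
  have h := frobeniusNumber_pair (hab.pow 2 2) (one_lt_pow₀ (by omega : 1 < a) two_ne_zero)
    (one_lt_pow₀ (by omega : 1 < b) two_ne_zero)
  refine (Set.finite_Iic _).subset fun n hn => h.2 fun hn' => hn ?_
  exact AddSubmonoid.closure_mono (by intro x; simp; tauto) hn'

/-- The basis element of the integral group ring of `ZMod m` attached to a residue `v`. -/
noncomputable def residueMonomial {m : ℕ} (v : ZMod m) : AddMonoidAlgebra ℤ (ZMod m) :=
  AddMonoidAlgebra.single v 1

local notation "χ" => residueMonomial

theorem residueMonomial_add {m : ℕ} (u v : ZMod m) : χ (u + v) = χ u * χ v := by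
  simp [residueMonomial, AddMonoidAlgebra.single_mul_single]

theorem residueMonomial_zero {m : ℕ} : χ (0 : ZMod m) = 1 := rfl

theorem residueMonomial_mul_natCast {m : ℕ} (v : ZMod m) (n : ℕ) :
    χ (v * (n : ZMod m)) = χ v ^ n := by
  simp [residueMonomial, AddMonoidAlgebra.single_pow, mul_comm]

theorem coeff_residueMonomial {m : ℕ} (v c : ZMod m) :
    (χ v).coeff c = if v = c then 1 else 0 := by
  simp [residueMonomial, Finsupp.single_apply]

theorem coeff_one_sub_residueMonomial_mul {m : ℕ} (v c : ZMod m)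
    (h : AddMonoidAlgebra ℤ (ZMod m)) :
    ((1 - χ v) * h).coeff c = h.coeff c - h.coeff (c - v) := by
  simp [residueMonomial, sub_mul, neg_add_eq_sub]

theorem coeff_eq_of_one_sub_residueMonomial_mul_eq_zero {m : ℕ} [NeZero m] {v : ZMod m}
    (hv : IsUnit v) {h : AddMonoidAlgebra ℤ (ZMod m)} (hh : (1 - χ v) * h = 0) (r s : ZMod m) :
    h.coeff r = h.coeff s := by
  have shift (c : ZMod m) : h.coeff (c + v) = h.coeff c := by
    have := coeff_one_sub_residueMonomial_mul v (c + v) h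
    rw [hh] at this
    simp only [AddMonoidAlgebra.coeff_zero, Finsupp.coe_zero, Pi.zero_apply,
      add_sub_cancel_right] at this
    linarith
  have shifts (n : ℕ) : h.coeff (s + n * v) = h.coeff s := by
    induction n with
    | zero => simp
    | succ n ih => rw [← ih, ← shift (s + n * v)]; push_cast; ring_nf
  obtain ⟨w, hw⟩ := hv.exists_left_inv
  have := shifts ((r - s) * w).val
  rwa [ZMod.natCast_zmod_val, mul_assoc, hw, mul_one, add_sub_cancel] at this

theorem sum_coeff_one_sub_residueMonomial_mul {m : ℕ} [NeZero m] (v : ZMod m)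
    (h : AddMonoidAlgebra ℤ (ZMod m)) : ∑ c, ((1 - χ v) * h).coeff c = 0 := by
  simp only [coeff_one_sub_residueMonomial_mul, Finset.sum_sub_distrib, sub_eq_zero]
  exact (Equiv.sum_comp (Equiv.subRight v) h.coeff).symm

theorem eq_zero_of_one_sub_residueMonomial_mul_eq_zero {m : ℕ} [NeZero m] {v : ZMod m}
    (hv : IsUnit v) {h : AddMonoidAlgebra ℤ (ZMod m)} (hh : (1 - χ v) * h = 0)
    (hs : ∑ c, h.coeff c = 0) : h = 0 := by
  ext r
  rw [Finset.sum_congr rfl fun c _ =>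
    coeff_eq_of_one_sub_residueMonomial_mul_eq_zero hv hh c r] at hs
  simpa [NeZero.ne m] using hs

theorem one_sub_residueMonomial_mul_cancel {m : ℕ} [NeZero m] {v w w' : ZMod m} (hv : IsUnit v)
    {h h' : AddMonoidAlgebra ℤ (ZMod m)}
    (hh : (1 - χ v) * ((1 - χ w) * h) = (1 - χ v) * ((1 - χ w') * h')) :
    (1 - χ w) * h = (1 - χ w') * h' := by
  rw [← sub_eq_zero, ← mul_sub] at hh
  refine sub_eq_zero.1 (eq_zero_of_one_sub_residueMonomial_mul_eq_zero hv hh ?_)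
  simp [Finset.sum_sub_distrib, sum_coeff_one_sub_residueMonomial_mul]

theorem residues_eq_of_prod_two {m : ℕ} [NeZero m] [Nontrivial (ZMod m)] {u₁ u₂ v₁ v₂ : ZMod m}
    (hu₁ : IsUnit u₁) (hu₂ : IsUnit u₂)
    (h : (1 - χ u₁) * (1 - χ u₂) = (1 - χ v₁) * (1 - χ v₂)) :
    u₁ = v₁ ∧ u₂ = v₂ ∨ u₁ = v₂ ∧ u₂ = v₁ := by
  have key (c : ZMod m) := congrArg (fun x => x.coeff c)
    (show χ (u₁ + u₂) + χ v₁ + χ v₂ = χ (v₁ + v₂) + χ u₁ + χ u₂ by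
      simp only [residueMonomial_add]; linear_combination h)
  simp only [AddMonoidAlgebra.coeff_add, Finsupp.coe_add, Pi.add_apply,
    coeff_residueMonomial] at key
  have := hu₁.ne_zero
  have := hu₂.ne_zero
  have h1 := key u₁
  have h2 := key u₂
  simp only [add_eq_left, add_eq_right, *, if_false, if_true] at h1 h2
  grind

theorem exists_common_residue_of_prod_three {m : ℕ} [NeZero m] [Nontrivial (ZMod m)]
    {u₁ u₂ u₃ v₁ v₂ v₃ : ZMod m}
    (hu₁ : IsUnit u₁) (hu₂ : IsUnit u₂) (hu₃ : IsUnit u₃) (hv₁ : IsUnit v₁)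
    (h : (1 - χ u₁) * (1 - χ u₂) * (1 - χ u₃) = (1 - χ v₁) * (1 - χ v₂) * (1 - χ v₃)) :
    ∃ u ∈ [u₁, u₂, u₃], u ∈ [v₁, v₂, v₃] := by
  by_contra! hne
  simp only [List.mem_cons, List.not_mem_nil, or_false, forall_eq_or_imp, forall_eq, not_or] at hne
  obtain ⟨⟨n11, n12, n13⟩, ⟨n21, n22, n23⟩, ⟨n31, n32, n33⟩⟩ := hne
  have two : (2 : ZMod m) ≠ 0 := by
    intro h2
    have : m ∣ 2 := (ZMod.natCast_eq_zero_iff 2 m).1 (by exact_mod_cast h2)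
    have hm1 : m ≠ 1 := by
      rintro rfl
      exact not_subsingleton (ZMod 1) inferInstance
    obtain rfl : m = 2 := ((Nat.dvd_prime Nat.prime_two).1 this).resolve_left hm1
    have unit2 : ∀ x : ZMod 2, x ≠ 0 → x = 1 := by decide
    exact n11 ((unit2 _ hu₁.ne_zero).trans (unit2 _ hv₁.ne_zero).symm)
  have two' {u : ZMod m} (hu : IsUnit u) : u + u ≠ 0 := by
    rw [← two_mul]
    exact fun h0 => two ((hu.mul_left_eq_zero).1 h0)
  have t1 := two' hu₁
  have t2 := two' hu₂
  have t3 := two' hu₃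
  have key (c : ZMod m) := congrArg (fun x => x.coeff c)
    (show χ (u₁ + u₂) + χ (u₁ + u₃) + χ (u₂ + u₃) + χ v₁ + χ v₂ + χ v₃ + χ (v₁ + v₂ + v₃) =
        χ (v₁ + v₂) + χ (v₁ + v₃) + χ (v₂ + v₃) + χ u₁ + χ u₂ + χ u₃ + χ (u₁ + u₂ + u₃) by
      simp only [residueMonomial_add]; linear_combination h)
  simp only [AddMonoidAlgebra.coeff_add, Finsupp.coe_add, Pi.add_apply,
    coeff_residueMonomial] at key
  have z1 := hu₁.ne_zero
  have z2 := hu₂.ne_zero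
  have z3 := hu₃.ne_zero
  have pos (p : Prop) [Decidable p] : (0 : ℤ) ≤ if p then 1 else 0 := by split_ifs <;> simp
  have w1 : u₂ + u₃ = u₁ ∨ v₁ + v₂ + v₃ = u₁ ∧ u₂ ≠ u₁ ∧ u₃ ≠ u₁ := by
    have k := key u₁
    have p1 := pos (v₁ + v₂ = u₁)
    have p2 := pos (v₁ + v₃ = u₁)
    have p3 := pos (v₂ + v₃ = u₁)
    have p4 := pos (u₁ + u₂ + u₃ = u₁)
    simp only [add_eq_left, Ne.symm n11, Ne.symm n12, Ne.symm n13, z2, z3, if_false, if_true] at k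
    grind
  have w2 : u₁ + u₃ = u₂ ∨ v₁ + v₂ + v₃ = u₂ ∧ u₁ ≠ u₂ ∧ u₃ ≠ u₂ := by
    have k := key u₂
    have p1 := pos (v₁ + v₂ = u₂)
    have p2 := pos (v₁ + v₃ = u₂)
    have p3 := pos (v₂ + v₃ = u₂)
    have p4 := pos (u₁ + u₂ + u₃ = u₂)
    simp only [add_eq_left, add_eq_right, Ne.symm n21, Ne.symm n22, Ne.symm n23, z1, z3,
      if_false, if_true] at k
    grind
  have w3 : u₁ + u₂ = u₃ ∨ v₁ + v₂ + v₃ = u₃ ∧ u₁ ≠ u₃ ∧ u₂ ≠ u₃ := by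
    have k := key u₃
    have p1 := pos (v₁ + v₂ = u₃)
    have p2 := pos (v₁ + v₃ = u₃)
    have p3 := pos (v₂ + v₃ = u₃)
    have p4 := pos (u₁ + u₂ + u₃ = u₃)
    simp only [add_eq_right, Ne.symm n31, Ne.symm n32, Ne.symm n33, z1, z2, if_false,
      if_true] at k
    grind
  grind

theorem residues_eq_of_prod_three_of_eq {m : ℕ} [NeZero m] [Nontrivial (ZMod m)]
    {u u₁ u₂ v v₁ v₂ : ZMod m} (hu : IsUnit u) (hu₁ : IsUnit u₁) (hu₂ : IsUnit u₂) (e : u = v)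
    (h : (1 - χ u) * (1 - χ u₁) * (1 - χ u₂) = (1 - χ v) * (1 - χ v₁) * (1 - χ v₂)) :
    u₁ = v₁ ∧ u₂ = v₂ ∨ u₁ = v₂ ∧ u₂ = v₁ := by
  subst e
  exact residues_eq_of_prod_two hu₁ hu₂
    (one_sub_residueMonomial_mul_cancel hu (by linear_combination h))

theorem residues_eq_of_prod_three {m : ℕ} [NeZero m] [Nontrivial (ZMod m)]
    {u₁ u₂ u₃ v₁ v₂ v₃ : ZMod m}
    (hu₁ : IsUnit u₁) (hu₂ : IsUnit u₂) (hu₃ : IsUnit u₃) (hv₁ : IsUnit v₁)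
    (h : (1 - χ u₁) * (1 - χ u₂) * (1 - χ u₃) = (1 - χ v₁) * (1 - χ v₂) * (1 - χ v₃)) :
    u₁ = v₁ ∧ (u₂ = v₂ ∧ u₃ = v₃ ∨ u₂ = v₃ ∧ u₃ = v₂) ∨
      u₁ = v₂ ∧ (u₂ = v₁ ∧ u₃ = v₃ ∨ u₂ = v₃ ∧ u₃ = v₁) ∨
      u₁ = v₃ ∧ (u₂ = v₁ ∧ u₃ = v₂ ∨ u₂ = v₂ ∧ u₃ = v₁) := by
  obtain ⟨u, hu, hv⟩ := exists_common_residue_of_prod_three hu₁ hu₂ hu₃ hv₁ h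
  simp only [List.mem_cons, List.not_mem_nil, or_false] at hu hv
  have c₁ {v v' v'' : ZMod m} (e : u₁ = v)
      (h' : (1 - χ v) * (1 - χ v') * (1 - χ v'') = (1 - χ v₁) * (1 - χ v₂) * (1 - χ v₃)) :
      u₂ = v' ∧ u₃ = v'' ∨ u₂ = v'' ∧ u₃ = v' :=
    residues_eq_of_prod_three_of_eq hu₁ hu₂ hu₃ e (h.trans h'.symm)
  have c₂ {v v' v'' : ZMod m} (e : u₂ = v)
      (h' : (1 - χ v) * (1 - χ v') * (1 - χ v'') = (1 - χ v₁) * (1 - χ v₂) * (1 - χ v₃)) :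
      u₁ = v' ∧ u₃ = v'' ∨ u₁ = v'' ∧ u₃ = v' :=
    residues_eq_of_prod_three_of_eq hu₂ hu₁ hu₃ e (by linear_combination h - h')
  have c₃ {v v' v'' : ZMod m} (e : u₃ = v)
      (h' : (1 - χ v) * (1 - χ v') * (1 - χ v'') = (1 - χ v₁) * (1 - χ v₂) * (1 - χ v₃)) :
      u₁ = v' ∧ u₂ = v'' ∨ u₁ = v'' ∧ u₂ = v' :=
    residues_eq_of_prod_three_of_eq hu₃ hu₁ hu₂ e (by linear_combination h - h')
  have e₁ : (1 - χ v₁) * (1 - χ v₂) * (1 - χ v₃) = (1 - χ v₁) * (1 - χ v₂) * (1 - χ v₃) := rfl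
  have e₂ : (1 - χ v₂) * (1 - χ v₁) * (1 - χ v₃) = (1 - χ v₁) * (1 - χ v₂) * (1 - χ v₃) := by ring
  have e₃ : (1 - χ v₃) * (1 - χ v₁) * (1 - χ v₂) = (1 - χ v₁) * (1 - χ v₂) * (1 - χ v₃) := by ring
  rcases hu with rfl | rfl | rfl <;> rcases hv with hv | hv | hv
  · rcases c₁ hv e₁ with h | h <;> simp [hv, h]
  · rcases c₁ hv e₂ with h | h <;> simp [hv, h]
  · rcases c₁ hv e₃ with h | h <;> simp [hv, h]
  · rcases c₂ hv e₁ with h | h <;> simp [hv, h]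
  · rcases c₂ hv e₂ with h | h <;> simp [hv, h]
  · rcases c₂ hv e₃ with h | h <;> simp [hv, h]
  · rcases c₃ hv e₁ with h | h <;> simp [hv, h]
  · rcases c₃ hv e₂ with h | h <;> simp [hv, h]
  · rcases c₃ hv e₃ with h | h <;> simp [hv, h]

theorem equidistMod_coe_iff {m : ℕ} [NeZero m] (G : Finset ℕ) :
    EquidistMod (G : Set ℕ) m ↔ (1 - χ 1) * ∑ n ∈ G, χ (n : ZMod m) = 0 := by
  have card_eq (r : ZMod m) : (Nat.card {n : ℕ // n ∈ (G : Set ℕ) ∧ (n : ZMod m) = r} : ℤ) =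
      (∑ n ∈ G, χ (n : ZMod m)).coeff r := by
    simp only [AddMonoidAlgebra.coeff_sum, Finsupp.coe_finsetSum, Finset.sum_apply,
      coeff_residueMonomial, Finset.sum_boole, Finset.mem_coe]
    rw [Nat.subtype_card (G.filter fun n : ℕ => (n : ZMod m) = r) (by simp)]
  constructor
  · intro h
    ext r
    rw [coeff_one_sub_residueMonomial_mul, ← card_eq, ← card_eq, h r (r - 1)]
    simp
  · intro h r s
    have := coeff_eq_of_one_sub_residueMonomial_mul_eq_zero isUnit_one h r s
    rw [← card_eq, ← card_eq] at this
    exact_mod_cast this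

theorem one_sub_mul_gapSum_mul {a b m : ℕ} (hb : 0 < b) (hab : Nat.Coprime a b) {G : Finset ℕ}
    (hG : ∀ n, n ∈ G ↔ n ∉ AddSubmonoid.closure {a ^ 2, a * b, b ^ 2}) :
    (1 - χ 1) * (∑ n ∈ G, χ (n : ZMod m)) * (1 - χ ((b : ZMod m) ^ 2)) =
      1 - χ ((b : ZMod m) ^ 2) - (1 - χ 1) * ((∑ i ∈ Finset.range b, χ ((a : ZMod m) ^ 2) ^ i) *
        ∑ j ∈ Finset.range b, χ ((a : ZMod m) * (b : ZMod m)) ^ j) := by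
  have h := sum_gaps_add_sum_normalForm hb hab hG (fun n => χ (n : ZMod m))
  simp only [Nat.cast_add, Nat.cast_mul, Nat.cast_pow, residueMonomial_add,
    residueMonomial_mul_natCast, ← Finset.sum_mul, ← Finset.mul_sum] at h
  have hr : ∑ n ∈ Finset.range (b ^ 2), χ (n : ZMod m) =
      ∑ n ∈ Finset.range (b ^ 2), χ (1 : ZMod m) ^ n :=
    Finset.sum_congr rfl fun n _ => by rw [← residueMonomial_mul_natCast, one_mul]
  have hg := geom_sum_mul_neg (χ (1 : ZMod m)) (b ^ 2)
  rw [← residueMonomial_mul_natCast, one_mul, Nat.cast_pow] at hg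
  have hab' : χ ((a : ZMod m) * (b : ZMod m)) = χ (a : ZMod m) ^ b :=
    residueMonomial_mul_natCast _ b
  rw [hr] at h
  rw [hab']
  linear_combination (1 - χ 1) * h + hg

theorem one_sub_mul_gapSum_mul_prod {a b m : ℕ} (hb : 0 < b) (hab : Nat.Coprime a b)
    {G : Finset ℕ} (hG : ∀ n, n ∈ G ↔ n ∉ AddSubmonoid.closure {a ^ 2, a * b, b ^ 2}) :
    (1 - χ ((a : ZMod m) ^ 2)) * ((1 - χ ((a : ZMod m) * (b : ZMod m))) *
      ((1 - χ ((b : ZMod m) ^ 2)) * ((1 - χ 1) * ∑ n ∈ G, χ (n : ZMod m)))) =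
    (1 - χ ((a : ZMod m) ^ 2)) * (1 - χ ((a : ZMod m) * (b : ZMod m))) *
        (1 - χ ((b : ZMod m) ^ 2)) -
      (1 - χ 1) * (1 - χ ((a : ZMod m) ^ 2 * (b : ZMod m))) *
        (1 - χ ((a : ZMod m) * (b : ZMod m) ^ 2)) := by
  have h1 := geom_sum_mul_neg (χ ((a : ZMod m) ^ 2)) b
  have h2 := geom_sum_mul_neg (χ ((a : ZMod m) * (b : ZMod m))) b
  rw [← residueMonomial_mul_natCast] at h1 h2
  rw [mul_assoc, ← sq] at h2
  rw [← h1, mul_assoc _ _ (1 - χ ((a : ZMod m) * (b : ZMod m) ^ 2)), ← h2]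
  linear_combination (1 - χ ((a : ZMod m) ^ 2)) * (1 - χ ((a : ZMod m) * (b : ZMod m))) *
    one_sub_mul_gapSum_mul (m := m) hb hab hG

theorem coprime_of_one_sub_mul_gapSum_eq_zero {a b m : ℕ} (hb : 2 ≤ b) (hab : Nat.Coprime a b)
    {G : Finset ℕ} (hG : ∀ n, n ∈ G ↔ n ∉ AddSubmonoid.closure {a ^ 2, a * b, b ^ 2})
    (h : (1 - χ 1) * ∑ n ∈ G, χ (n : ZMod m) = 0) : Nat.Coprime a m := by
  refine Nat.Coprime.symm (Nat.coprime_of_dvd fun p hp hpm hpa => ?_)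
  have : Fact p.Prime := ⟨hp⟩
  let f := AddMonoidAlgebra.mapDomainRingHom ℤ (ZMod.castHom hpm (ZMod p)).toAddMonoidHom
  have hf (v : ZMod m) : f (χ v) = χ (ZMod.castHom hpm (ZMod p) v) := by
    simp [f, residueMonomial]
  have hp0 : (1 - χ 1) * ∑ n ∈ G, χ (n : ZMod p) = 0 := by
    simpa only [map_mul, map_sub, map_one, map_sum, hf, map_natCast, map_zero] using congrArg f h
  have key := one_sub_mul_gapSum_mul (m := p) (by omega) hab hG
  simp only [hp0, (ZMod.natCast_eq_zero_iff a p).2 hpa, zero_mul, ne_eq, two_ne_zero,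
    not_false_eq_true, zero_pow, residueMonomial_zero, one_pow, Finset.sum_const,
    Finset.card_range, nsmul_eq_mul, mul_one] at key
  have coeff_zero := congrArg (fun x => x.coeff 0)
    (show χ (0 : ZMod p) - χ ((b : ZMod p) ^ 2) - (1 - χ 1) * ((b ^ 2 : ℕ) • χ (0 : ZMod p)) = 0 by
      simp only [residueMonomial_zero, nsmul_eq_mul]; push_cast; linear_combination -key)
  simp only [AddMonoidAlgebra.coeff_sub, Finsupp.coe_sub, Pi.sub_apply,
    coeff_one_sub_residueMonomial_mul, AddMonoidAlgebra.coeff_smul, Finsupp.smul_apply,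
    coeff_residueMonomial] at coeff_zero
  simp at coeff_zero
  have : (4 : ℤ) ≤ (b : ℤ) ^ 2 := by
    have : (2 : ℤ) ≤ b := by exact_mod_cast hb
    nlinarith
  split_ifs at coeff_zero <;> linarith

theorem eq_one_or_of_eq_sq_perm {R : Type*} [CommRing R] {a b : R} (ha : IsUnit a)
    (hb : IsUnit b)
    (h : 1 = a ^ 2 ∧ (a ^ 2 * b = a * b ∧ a * b ^ 2 = b ^ 2 ∨
        a ^ 2 * b = b ^ 2 ∧ a * b ^ 2 = a * b) ∨
      1 = a * b ∧ (a ^ 2 * b = a ^ 2 ∧ a * b ^ 2 = b ^ 2 ∨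
        a ^ 2 * b = b ^ 2 ∧ a * b ^ 2 = a ^ 2) ∨
      1 = b ^ 2 ∧ (a ^ 2 * b = a ^ 2 ∧ a * b ^ 2 = a * b ∨
        a ^ 2 * b = a * b ∧ a * b ^ 2 = a ^ 2)) :
    a = 1 ∨ b = 1 ∨ a ^ 3 = 1 ∧ b ^ 3 = 1 ∧ a * b = 1 := by
  obtain ⟨x, hx⟩ := ha.exists_left_inv
  obtain ⟨y, hy⟩ := hb.exists_left_inv
  rcases h with ⟨h₁, ⟨h, -⟩ | ⟨h, -⟩⟩ | ⟨h₁, ⟨h, -⟩ | ⟨h, h'⟩⟩ | ⟨h₁, ⟨-, h⟩ | ⟨-, h⟩⟩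
  · left; linear_combination x * y * h - (a - 1) * (y * b * hx + hy)
  · right; left; linear_combination -y * (h + b * h₁) - (b - 1) * hy
  · left; linear_combination -x * (h + a * h₁) - (a - 1) * hx
  · right; right
    exact ⟨by linear_combination -a * h' - (a * b + 1) * h₁,
      by linear_combination -b * h - (a * b + 1) * h₁, h₁.symm⟩
  · right; left; linear_combination x * y * h - (b - 1) * (y * b * hx + hy)
  · left; linear_combination -x * (h + a * h₁) - (a - 1) * hx

theorem stmt_3 (a b m : ℕ) (ha : 2 ≤ a) (hb : 2 ≤ b) (hm : 0 < m)
    (hab : Nat.Coprime a b) :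
    EquidistMod {n : ℕ | n ∉ AddSubmonoid.closure {a ^ 2, a * b, b ^ 2}} m ↔
      Nat.Coprime (a * b) m ∧
        ((a : ZMod m) = 1 ∨ (b : ZMod m) = 1 ∨
          ((a : ZMod m) ^ 3 = 1 ∧ (b : ZMod m) ^ 3 = 1 ∧
            (a : ZMod m) * (b : ZMod m) = 1)) := by
  have : NeZero m := ⟨hm.ne'⟩
  have hfin := finite_gaps ha hb hab
  obtain ⟨G, hG'⟩ := hfin.exists_finset_coe
  have hG (n : ℕ) : n ∈ G ↔ n ∉ AddSubmonoid.closure {a ^ 2, a * b, b ^ 2} := by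
    rw [← Finset.mem_coe, hG', Set.mem_ofPred]
  have prod := one_sub_mul_gapSum_mul_prod (m := m) (by omega) hab hG
  rw [← hG', equidistMod_coe_iff]
  constructor
  · intro h
    have ham : Nat.Coprime a m := coprime_of_one_sub_mul_gapSum_eq_zero hb hab hG h
    have hbm : Nat.Coprime b m := by
      refine coprime_of_one_sub_mul_gapSum_eq_zero ha hab.symm (fun n => ?_) h
      rw [hG, mul_comm b a, Set.insert_comm (b ^ 2), Set.pair_comm (b ^ 2), Set.insert_comm (a * b)]
    refine ⟨ham.mul_left hbm, ?_⟩
    rcases subsingleton_or_nontrivial (ZMod m) with _ | _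
    · exact Or.inl (Subsingleton.elim _ _)
    have ua : IsUnit (a : ZMod m) := (ZMod.isUnit_iff_coprime a m).2 ham
    have ub : IsUnit (b : ZMod m) := (ZMod.isUnit_iff_coprime b m).2 hbm
    rw [h] at prod
    exact eq_one_or_of_eq_sq_perm ua ub (residues_eq_of_prod_three isUnit_one
      ((ua.pow 2).mul ub) (ua.mul (ub.pow 2)) (ua.pow 2) (by linear_combination prod))
  · rintro ⟨hc, h⟩
    rw [Nat.coprime_mul_iff_left] at hc
    have ua : IsUnit (a : ZMod m) := (ZMod.isUnit_iff_coprime a m).2 hc.1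
    have ub : IsUnit (b : ZMod m) := (ZMod.isUnit_iff_coprime b m).2 hc.2
    have prod_zero : (1 - χ ((a : ZMod m) ^ 2)) * (1 - χ ((a : ZMod m) * (b : ZMod m))) *
          (1 - χ ((b : ZMod m) ^ 2)) -
        (1 - χ 1) * (1 - χ ((a : ZMod m) ^ 2 * (b : ZMod m))) *
          (1 - χ ((a : ZMod m) * (b : ZMod m) ^ 2)) = 0 := by
      rcases h with h | h | ⟨h₁, h₂, h₃⟩
      · simp only [h, one_pow, one_mul]; ring
      · simp only [h, one_pow, mul_one]; ring
      · have e₁ : (a : ZMod m) ^ 2 * b = a := by linear_combination (a : ZMod m) * h₃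
        have e₂ : (a : ZMod m) * b ^ 2 = b := by linear_combination (b : ZMod m) * h₃
        have e₃ : (a : ZMod m) ^ 2 = b := by
          linear_combination (b : ZMod m) * h₁ - (a : ZMod m) ^ 2 * h₃
        have e₄ : (b : ZMod m) ^ 2 = a := by
          linear_combination (a : ZMod m) * h₂ - (b : ZMod m) ^ 2 * h₃
        rw [e₁, e₂, e₃, e₄, h₃]; ring
    rw [prod_zero] at prod
    have cancel {v w : ZMod m} (hv : IsUnit v) {x : AddMonoidAlgebra ℤ (ZMod m)}
        (hx : (1 - χ v) * ((1 - χ w) * x) = 0) : (1 - χ w) * x = 0 := by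
      simpa using one_sub_residueMonomial_mul_cancel (w' := w) (h' := 0) hv (by simpa using hx)
    exact cancel (ub.pow 2) (cancel (ua.mul ub) (cancel (ua.pow 2) prod))
end

section
/- Let m be a positive integer and let n ∈ {1, 2, 3}. Let c₁, …, c_n and d₁, …, d_n be positive integers each coprime to m. Then X^m − 1 divides ∏_{i=1}^{n} (X^{c_i} − 1) − ∏_{i=1}^{n} (X^{d_i} − 1) in ℤ[X] if and only if there exists a permutation σ of {1, …, n} such that c_i ≡ d_{σ(i)} (mod m) for all i. -/
open Polynomial

lemma prod_pow_sub_one_eq_of_dvd {R : Type*} [CommRing R] {m n : ℕ} {c d : Fin n → ℕ}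
    (h : ((X : ℤ[X]) ^ m - 1) ∣
      (∏ i, ((X : ℤ[X]) ^ (c i) - 1) - ∏ i, ((X : ℤ[X]) ^ (d i) - 1)))
    {x : R} (hx : x ^ m = 1) :
    ∏ i, (x ^ c i - 1) = ∏ i, (x ^ d i - 1) := by
  have h' := map_dvd (aeval x) h
  simpa [hx, map_prod, sub_eq_zero] using h'

lemma dvd_prod_sub_prod_of_modEq {m n : ℕ} {c d : Fin n → ℕ} {σ : Equiv.Perm (Fin n)}
    (h : ∀ i, c i ≡ d (σ i) [MOD m]) :
    ((X : ℤ[X]) ^ m - 1) ∣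
      (∏ i, ((X : ℤ[X]) ^ (c i) - 1) - ∏ i, ((X : ℤ[X]) ^ (d i) - 1)) := by
  rw [← Ideal.mem_span_singleton, ← Ideal.Quotient.mk_eq_mk_iff_sub_mem]
  set q := Ideal.Quotient.mk (Ideal.span {(X : ℤ[X]) ^ m - 1})
  have hq : q X ^ m = 1 := by
    rw [← map_pow, ← map_one q, Ideal.Quotient.mk_eq_mk_iff_sub_mem]
    exact Ideal.mem_span_singleton_self _
  simp only [map_prod, map_sub, map_pow, map_one]
  rw [← Equiv.prod_comp σ fun i => q X ^ d i - 1]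
  exact Finset.prod_congr rfl fun i _ => by rw [pow_eq_pow_of_modEq (h i) hq]

lemma inv_pow_sub_one {K : Type*} [Field K] {x : K} (hx : x ≠ 0) (k : ℕ) :
    x⁻¹ ^ k - 1 = -(x ^ k - 1) * (x ^ k)⁻¹ := by
  rw [inv_pow, neg_sub, sub_mul, one_mul, mul_inv_cancel₀ (pow_ne_zero k hx)]

/-- The exponent sums agree: compare the values at a primitive root of unity and its inverse. -/
lemma sum_modEq_of_dvd {m n : ℕ} (hm : 1 < m) {c d : Fin n → ℕ}
    (hc : ∀ i, Nat.Coprime (c i) m)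
    (h : ((X : ℤ[X]) ^ m - 1) ∣
      (∏ i, ((X : ℤ[X]) ^ (c i) - 1) - ∏ i, ((X : ℤ[X]) ^ (d i) - 1))) :
    ∑ i, c i ≡ ∑ i, d i [MOD m] := by
  have hζ := Complex.isPrimitiveRoot_exp m (by omega)
  set ζ := Complex.exp (2 * Real.pi * Complex.I / m)
  have hζ0 : ζ ≠ 0 := hζ.ne_zero (by omega)
  have h1 := prod_pow_sub_one_eq_of_dvd h hζ.pow_eq_one
  have h2 := prod_pow_sub_one_eq_of_dvd h hζ.inv.pow_eq_one
  simp only [inv_pow_sub_one hζ0, Finset.prod_mul_distrib, Finset.prod_neg, ← h1,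
    Finset.prod_inv_distrib, Finset.prod_pow_eq_pow_sum] at h2
  have hne : ∏ i, (ζ ^ c i - 1) ≠ 0 := Finset.prod_ne_zero_iff.2 fun i _ =>
    sub_ne_zero.2 ((hζ.pow_of_coprime _ (hc i)).ne_one hm)
  have h3 := inv_injective (mul_left_cancel₀ (mul_ne_zero (by simp) hne) h2)
  have hu : (Units.mk0 ζ hζ0) ^ ∑ i, c i = (Units.mk0 ζ hζ0) ^ ∑ i, d i :=
    Units.ext (by simpa using h3)
  rwa [pow_eq_pow_iff_modEq, ← orderOf_units, Units.val_mk0, ← hζ.eq_orderOf] at hu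

section GroupRing

variable {G : Type*}

/-- The group ring element attached to `g`. -/
noncomputable def groupRingOf (g : G) : AddMonoidAlgebra ℤ G := AddMonoidAlgebra.single g 1

lemma groupRingOf_coeff [DecidableEq G] (g k : G) :
    (groupRingOf g).coeff k = if g = k then 1 else 0 := by
  simp [groupRingOf, Finsupp.single_apply]

variable [AddCommGroup G]

lemma groupRingOf_add (g h : G) :
    groupRingOf (g + h) = groupRingOf g * groupRingOf h := by
  simp [groupRingOf, AddMonoidAlgebra.single_mul_single]

lemma groupRingOf_nsmul (g : G) (k : ℕ) : groupRingOf (k • g) = groupRingOf g ^ k := by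
  simp [groupRingOf, AddMonoidAlgebra.single_pow]

lemma eq_or_eq_of_groupRing_two {a b d e : G} (hs : a + b = d + e)
    (h : (groupRingOf a - 1) * (groupRingOf b - 1) =
      (groupRingOf d - 1) * (groupRingOf e - 1)) : a = d ∨ a = e := by
  have h1 : groupRingOf a + groupRingOf b = groupRingOf d + groupRingOf e := by
    have := congrArg groupRingOf hs
    simp only [groupRingOf_add] at this
    linear_combination this - h
  classical
  have h2 := congrArg (fun f => f.coeff a) h1
  simp only [AddMonoidAlgebra.coeff_add, Finsupp.add_apply, groupRingOf_coeff] at h2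
  grind

lemma groupRing_three {a b c d e f : G} (hs : a + b + c = d + e + f)
    (h : (groupRingOf a - 1) * (groupRingOf b - 1) * (groupRingOf c - 1) =
      (groupRingOf d - 1) * (groupRingOf e - 1) * (groupRingOf f - 1)) :
    groupRingOf a + groupRingOf b + groupRingOf c +
        groupRingOf (d + e) + groupRingOf (d + f) + groupRingOf (e + f) =
      groupRingOf d + groupRingOf e + groupRingOf f +
        groupRingOf (a + b) + groupRingOf (a + c) + groupRingOf (b + c) := by
  have := congrArg groupRingOf hs
  simp only [groupRingOf_add] at this ⊢
  linear_combination h - this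

lemma mem_or_eq_add_of_groupRing_three {a b c d e f : G} (hb : b ≠ 0) (hc : c ≠ 0)
    (hs : a + b + c = d + e + f)
    (h : (groupRingOf a - 1) * (groupRingOf b - 1) * (groupRingOf c - 1) =
      (groupRingOf d - 1) * (groupRingOf e - 1) * (groupRingOf f - 1)) :
    (a = d ∨ a = e ∨ a = f) ∨ a = b + c := by
  classical
  have h2 := congrArg (fun f => f.coeff a) (groupRing_three hs h)
  simp only [AddMonoidAlgebra.coeff_add, Finsupp.add_apply, groupRingOf_coeff,
    add_eq_left, hb, hc] at h2
  grind

lemma mem_or_mem_of_groupRing_three {a b c d e f : G} (ha : a ≠ 0) (hb : b ≠ 0)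
    (hc : c + c ≠ 0) (hs : a + b + c = d + e + f)
    (h : (groupRingOf a - 1) * (groupRingOf b - 1) * (groupRingOf c - 1) =
      (groupRingOf d - 1) * (groupRingOf e - 1) * (groupRingOf f - 1)) :
    (a = d ∨ a = e ∨ a = f) ∨ (b = d ∨ b = e ∨ b = f) := by
  have hc' : c ≠ 0 := by rintro rfl; simp at hc
  refine (mem_or_eq_add_of_groupRing_three hb hc' hs h).imp_right fun h1 => ?_
  refine (mem_or_eq_add_of_groupRing_three ha hc' (by rw [← hs]; abel)
    (by rw [← h]; ring)).resolve_right fun h2 => hc ?_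
  rw [h2, add_assoc] at h1
  exact left_eq_add.1 h1

lemma pair_eq_of_groupRing_three {a b c e f : G} (ha : a + a ≠ 0)
    (hs : a + b + c = a + e + f)
    (h : (groupRingOf a - 1) * (groupRingOf b - 1) * (groupRingOf c - 1) =
      (groupRingOf a - 1) * (groupRingOf e - 1) * (groupRingOf f - 1)) :
    (b = e ∧ c = f) ∨ (b = f ∧ c = e) := by
  classical
  have ha' : a ≠ 0 := by rintro rfl; simp at ha
  have hs' : b + c = e + f := by simpa [add_assoc] using hs
  have h1 := groupRing_three hs h
  rw [hs'] at h1
  have hbc := congrArg (fun f => f.coeff b) h1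
  have hcb := congrArg (fun f => f.coeff c) h1
  simp only [AddMonoidAlgebra.coeff_add, Finsupp.add_apply, groupRingOf_coeff,
    add_eq_right, ha'] at hbc hcb
  have hb' : (b = e ∨ b = f) ∨ a + c = b := by grind
  have hc' : (c = e ∨ c = f) ∨ a + b = c := by grind
  have key : (b = e ∨ b = f) ∨ (c = e ∨ c = f) := by
    rcases hb' with hb' | hb'
    · exact .inl hb'
    refine .inr (hc'.resolve_right fun hc' => ha ?_)
    rw [← hb', ← add_assoc] at hc'
    exact add_eq_right.1 hc'
  rcases key with (rfl | rfl) | (rfl | rfl)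
  · exact .inl ⟨rfl, by simpa using hs'⟩
  · exact .inr ⟨rfl, by rw [add_comm e] at hs'; simpa using hs'⟩
  · exact .inr ⟨by rw [add_comm c] at hs'; simpa using hs', rfl⟩
  · exact .inl ⟨by simpa using hs', rfl⟩

lemma exists_perm_of_groupRing_three {x y : Fin 3 → G} (hx : ∀ i, x i + x i ≠ 0)
    (hs : ∑ i, x i = ∑ i, y i)
    (h : ∏ i, (groupRingOf (x i) - 1) = ∏ i, (groupRingOf (y i) - 1)) :
    ∃ σ : Equiv.Perm (Fin 3), ∀ i, x i = y (σ i) := by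
  have hx0 : ∀ i, x i ≠ 0 := fun i hi => hx i (by simp [hi])
  have match_step : ∀ τ ρ : Equiv.Perm (Fin 3), x (τ 0) = y (ρ 0) →
      ∃ σ : Equiv.Perm (Fin 3), ∀ i, x i = y (σ i) := by
    intro τ ρ h0
    rw [← Equiv.sum_comp τ x, ← Equiv.sum_comp ρ y] at hs
    rw [← Equiv.prod_comp τ fun i => groupRingOf (x i) - 1,
      ← Equiv.prod_comp ρ fun i => groupRingOf (y i) - 1] at h
    simp only [Fin.sum_univ_three, Fin.prod_univ_three] at hs h
    rw [← h0] at hs h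
    suffices ∃ σ : Equiv.Perm (Fin 3), ∀ i, x (τ i) = y (ρ (σ i)) by
      obtain ⟨σ, hσ⟩ := this
      exact ⟨τ.symm.trans (σ.trans ρ), fun i => by simpa using hσ (τ.symm i)⟩
    rcases pair_eq_of_groupRing_three (hx _) hs h with ⟨h1, h2⟩ | ⟨h1, h2⟩
    · exact ⟨1, by simp [Fin.forall_fin_succ, h0, h1, h2]⟩
    · refine ⟨Equiv.swap 1 2, fun i => ?_⟩
      fin_cases i
      · exact h0
      · exact h1
      · exact h2
  have match_any : ∀ i j, x i = y j → ∃ σ : Equiv.Perm (Fin 3), ∀ i, x i = y (σ i) :=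
    fun i j hij => match_step (Equiv.swap 0 i) (Equiv.swap 0 j) (by simpa using hij)
  simp only [Fin.sum_univ_three, Fin.prod_univ_three] at hs h
  rcases mem_or_mem_of_groupRing_three (hx0 0) (hx0 1) (hx 2) hs h with
    (h | h | h) | (h | h | h) <;> exact match_any _ _ h

lemma exists_perm_of_groupRing_two {x y : Fin 2 → G} (hs : ∑ i, x i = ∑ i, y i)
    (h : ∏ i, (groupRingOf (x i) - 1) = ∏ i, (groupRingOf (y i) - 1)) :
    ∃ σ : Equiv.Perm (Fin 2), ∀ i, x i = y (σ i) := by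
  simp only [Fin.sum_univ_two, Fin.prod_univ_two] at hs h
  rcases eq_or_eq_of_groupRing_two hs h with h0 | h0
  · rw [h0] at hs
    exact ⟨1, by simpa [Fin.forall_fin_two, h0] using hs⟩
  · rw [h0, add_comm (y 0)] at hs
    exact ⟨Equiv.swap 0 1, by simpa [Fin.forall_fin_two, h0] using hs⟩

end GroupRing

theorem stmt_4 (m n : ℕ) (hm : 0 < m) (hn : n = 1 ∨ n = 2 ∨ n = 3)
    (c d : Fin n → ℕ)
    (hc : ∀ i, 0 < c i ∧ Nat.Coprime (c i) m)
    (hd : ∀ i, 0 < d i ∧ Nat.Coprime (d i) m) :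
    ((X : ℤ[X]) ^ m - 1) ∣
        (∏ i, ((X : ℤ[X]) ^ (c i) - 1) - ∏ i, ((X : ℤ[X]) ^ (d i) - 1)) ↔
      ∃ σ : Equiv.Perm (Fin n), ∀ i, c i ≡ d (σ i) [MOD m] := by
  refine ⟨fun h => ?_, fun ⟨σ, hσ⟩ => dvd_prod_sub_prod_of_modEq hσ⟩
  by_cases hm2 : m ≤ 2
  · refine ⟨1, fun i => ?_⟩
    have h1 := (hc i).2
    have h2 := (hd i).2
    obtain rfl | rfl : m = 1 ∨ m = 2 := by omega
    · exact Nat.modEq_one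
    · rw [Nat.coprime_two_right, Nat.odd_iff] at h1 h2
      exact h1.trans h2.symm
  have hs := sum_modEq_of_dvd (by omega) (fun i => (hc i).2) h
  have hx : groupRingOf (1 : ZMod m) ^ m = 1 := by
    rw [← groupRingOf_nsmul]
    simp [groupRingOf, AddMonoidAlgebra.one_def]
  have hg := prod_pow_sub_one_eq_of_dvd h hx
  simp only [← groupRingOf_nsmul, nsmul_eq_mul, mul_one] at hg
  simp only [← ZMod.natCast_eq_natCast_iff] at hs ⊢
  push_cast at hs
  rcases hn with rfl | rfl | rfl
  · exact ⟨1, fun i => by simpa [Subsingleton.elim i 0] using hs⟩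
  · exact exists_perm_of_groupRing_two hs hg
  · refine exists_perm_of_groupRing_three (fun i hi => hm2 ?_) hs hg
    rw [← Nat.cast_add, ZMod.natCast_eq_zero_iff, ← two_mul] at hi
    exact Nat.le_of_dvd two_pos ((hc i).2.symm.dvd_of_dvd_mul_right hi)
end

section
/- Let m = p^t be a power of a prime p (with t ≥ 1). Let c₁, …, c_n and d₁, …, d_n be positive integers each coprime to m, and suppose X^m − 1 divides ∏_{i=1}^{n} (X^{c_i} − 1) − ∏_{i=1}^{n} (X^{d_i} − 1) in ℤ[X]. Then there exists a permutation σ of {1, …, n} such that for every i, either c_i ≡ d_{σ(i)} (mod m) or c_i + d_{σ(i)} ≡ 0 (mod m). -/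
section CyclotomicUnits

open Complex Filter Topology MeasureTheory Set

theorem one_sub_mul_exp_neg_re_pos {z : ℂ} (hz : ‖z‖ = 1) (hz1 : z ≠ 1) {t : ℝ} (ht : 0 ≤ t) :
    0 < (1 - z * Real.exp (-t)).re := by
  have hre : z.re < 1 := by
    have h := Complex.sq_norm z
    rw [hz, Complex.normSq_apply] at h
    by_contra! h1
    have him : z.im = 0 := by nlinarith
    have hre : z.re = 1 := by nlinarith
    exact hz1 (Complex.ext hre him)
  have h0 := Real.exp_pos (-t)
  have h1 : Real.exp (-t) ≤ 1 := Real.exp_le_one_iff.2 (by linarith)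
  rw [sub_re, re_mul_ofReal, one_re]
  nlinarith

/-- The periodic zeta function at `s = 1` is `-log (1 - exp (2πia))`, by its Mellin transform
formula. -/
theorem expZeta_one {a : ℝ} (ha : (a : UnitAddCircle) ≠ 0) {z : ℂ}
    (hza : z = cexp (2 * Real.pi * I * a)) (hz1 : z ≠ 1) :
    HurwitzZeta.expZeta a 1 = -log (1 - z) := by
  have hz : ‖z‖ = 1 := by
    rw [hza, show (2 * Real.pi * I * a : ℂ) = ((2 * Real.pi * a : ℝ) : ℂ) * I by push_cast; ring]
    exact norm_exp_ofReal_mul_I _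
  set F : ℝ → ℂ := fun t ↦ z * Real.exp (-t) / (1 - z * Real.exp (-t)) with hF
  have hpos {t : ℝ} (ht : 0 ≤ t) := one_sub_mul_exp_neg_re_pos hz hz1 ht
  have hne {t : ℝ} (ht : 0 ≤ t) : 1 - z * Real.exp (-t) ≠ 0 := fun h ↦
    (hpos ht).ne' (by rw [h, zero_re])
  have hcont : ContinuousOn F (Ici 0) := by
    apply ContinuousOn.div (by fun_prop) (by fun_prop)
    exact fun t ht ↦ hne ht
  have hlim0 : Tendsto (fun t : ℝ ↦ z * (Real.exp (-t) : ℂ)) atTop (𝓝 0) := by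
    have h : Tendsto (fun t : ℝ ↦ (Real.exp (-t) : ℂ)) atTop (𝓝 ((0 : ℝ) : ℂ)) :=
      (continuous_ofReal.tendsto _).comp Real.tendsto_exp_neg_atTop_nhds_zero
    simpa using h.const_mul z
  have hlim : Tendsto (fun t : ℝ ↦ 1 - z * (Real.exp (-t) : ℂ)) atTop (𝓝 1) := by
    simpa using hlim0.const_sub 1
  have htop : F =O[atTop] fun t ↦ Real.exp (-1 * t) := by
    have h1 : (fun t : ℝ ↦ z * (Real.exp (-t) : ℂ)) =O[atTop] fun t ↦ Real.exp (-1 * t) := by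
      refine Asymptotics.IsBigO.of_bound 1 (Eventually.of_forall fun t ↦ ?_)
      rw [norm_mul, hz, norm_real, neg_one_mul]
    have h2 : (fun t : ℝ ↦ (1 - z * (Real.exp (-t) : ℂ))⁻¹) =O[atTop] fun _ ↦ (1 : ℝ) :=
      (hlim.inv₀ one_ne_zero).isBigO_one ℝ
    simpa [hF, div_eq_mul_inv] using h1.mul h2
  have hbot : F =O[𝓝[>] 0] (fun t : ℝ ↦ t ^ (-0 : ℝ)) := by
    have h : Tendsto F (𝓝[>] 0) (𝓝 (F 0)) :=
      ((hcont 0 self_mem_Ici).mono Ioi_subset_Ici_self)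
    simpa using h.isBigO_one ℝ
  have hloc : LocallyIntegrableOn F (Ioi 0) :=
    (hcont.mono Ioi_subset_Ici_self).locallyIntegrableOn measurableSet_Ioi
  have hmellin (s : ℂ) (hs : 1 < s.re) : mellin F s = Gamma s * HurwitzZeta.expZeta a s := by
    have hs0 : s ≠ 0 := by rintro rfl; norm_num at hs
    have h1 := (hasSum_mellin (a := fun n : ℕ ↦ if n = 0 then 0 else z ^ n)
      (p := fun n : ℕ ↦ (n : ℝ)) (F := F) (s := s) ?_ (by linarith) ?_ ?_)
    · have h2 := (HurwitzZeta.hasSum_expZeta_of_one_lt_re a hs).mul_left (Gamma s)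
      refine h1.unique (h2.congr_fun fun n ↦ ?_)
      rcases eq_or_ne n 0 with rfl | hn
      · simp [hs0]
      · simp only [hn, if_false]
        rw [hza, ← Complex.exp_nat_mul, mul_comm (n : ℂ), mul_div_assoc, ofReal_natCast]
    · intro n
      rcases eq_or_ne n 0 with rfl | hn
      · simp
      · right; positivity
    · intro t ht
      have hlt : ‖z * (Real.exp (-t) : ℂ)‖ < 1 := by
        rw [norm_mul, hz, one_mul, norm_real, Real.norm_of_nonneg (Real.exp_pos _).le]
        exact Real.exp_lt_one_iff.2 (by simpa using ht)
      have h3 := (hasSum_geometric_of_norm_lt_one hlt).mul_left (z * (Real.exp (-t) : ℂ))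
      rw [← hasSum_nat_add_iff' 1]
      simp only [Finset.range_one, Finset.sum_singleton, if_true, zero_mul, sub_zero,
        Nat.succ_ne_zero, if_false]
      refine h3.congr_fun fun n ↦ ?_
      rw [← pow_succ', mul_pow, ← ofReal_pow, ← Real.exp_nat_mul]
      congr 3
      push_cast
      ring
    · refine Summable.of_norm_bounded (g := fun n : ℕ ↦ 1 / (n : ℝ) ^ s.re)
        (Real.summable_one_div_nat_rpow.2 hs) fun n ↦ ?_
      rw [Real.norm_of_nonneg (by positivity)]
      gcongr
      split_ifs <;> simp [hz]
  have hd1 : ContinuousAt (mellin F) 1 :=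
    (mellin_differentiableAt_of_isBigO_rpow_exp one_pos hloc htop hbot (by simp)).continuousAt
  have hd2 : ContinuousAt (fun s ↦ Gamma s * HurwitzZeta.expZeta a s) 1 := by
    refine (DifferentiableAt.mul (differentiableAt_Gamma _ fun n h ↦ ?_)
      (HurwitzZeta.differentiableAt_expZeta _ _ (.inr ha))).continuousAt
    have := congrArg re h
    simp at this
    linarith [n.cast_nonneg (α := ℝ)]
  have hseq : Tendsto (fun x : ℝ ↦ (x : ℂ)) (𝓝[>] 1) (𝓝 1) :=
    (continuous_ofReal.tendsto' 1 1 ofReal_one).mono_left nhdsWithin_le_nhds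
  have heq : mellin F 1 = HurwitzZeta.expZeta a 1 := by
    have h := tendsto_nhds_unique_of_eventuallyEq (hd1.tendsto.comp hseq) (hd2.tendsto.comp hseq)
      (eventually_mem_nhdsWithin.mono fun x hx ↦ hmellin x (by simpa using hx))
    simpa using h
  have hint : IntegrableOn F (Ioi 0) := by
    have h := mellinConvergent_of_isBigO_rpow_exp one_pos hloc htop hbot (s := 1) (by simp)
    simpa [MellinConvergent] using h
  rw [← heq, mellin]
  simp only [sub_self, cpow_zero, one_smul]
  rw [integral_Ioi_of_hasDerivAt_of_tendsto (f := fun t : ℝ ↦ log (1 - z * Real.exp (-t)))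
    (m := log 1) ?_ ?_ hint ((continuousAt_clog (by simp)).tendsto.comp hlim)]
  · simp
  · exact ContinuousWithinAt.clog (by fun_prop) (.inl (hpos le_rfl))
  · intro t ht
    replace ht : 0 < t := ht
    have h1 : HasDerivAt (fun t : ℝ ↦ (Real.exp (-t) : ℂ)) (-(Real.exp (-t) : ℂ)) t := by
      have := ((hasDerivAt_neg t).exp).ofReal_comp
      simpa using this
    have h2 := (h1.const_mul z).const_sub 1
    have h3 := h2.clog_real (.inl (hpos (le_of_lt ht)))
    exact h3.congr_deriv (by simp [hF])

open ZMod DirichletCharacter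

theorem expZeta_toAddCircle_one {N : ℕ} [NeZero N] {j : ZMod N} (hj : j ≠ 0) :
    HurwitzZeta.expZeta (toAddCircle j) 1 = -log (1 - stdAddChar j) := by
  have hne : toAddCircle j ≠ 0 := by rwa [ne_eq, toAddCircle_eq_zero]
  rw [toAddCircle_apply] at hne ⊢
  refine expZeta_one hne ?_ ?_
  · have h := stdAddChar_coe (N := N) (j.val : ℤ)
    rw [Int.cast_natCast, natCast_zmod_val] at h
    rw [h]
    push_cast
    ring_nf
  · rwa [← AddChar.map_zero_eq_one (stdAddChar (N := N)), ne_eq, injective_stdAddChar.eq_iff]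

theorem log_add_log_conj (w : ℂ) (hw : w ∈ slitPlane) :
    log w + log (starRingEnd ℂ w) = 2 * (Real.log ‖w‖ : ℂ) := by
  rw [log_conj _ (slitPlane_arg_ne_pi hw), add_conj, log_re]
  push_cast
  rfl

theorem one_sub_stdAddChar_mem_slitPlane {N : ℕ} [NeZero N] {j : ZMod N} (hj : j ≠ 0) :
    1 - stdAddChar j ∈ slitPlane := by
  have h1 : stdAddChar j ≠ 1 := by
    rwa [← AddChar.map_zero_eq_one (stdAddChar (N := N)), ne_eq, injective_stdAddChar.eq_iff]
  have := one_sub_mul_exp_neg_re_pos (AddChar.norm_apply _ _) h1 le_rfl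
  exact .inl (by simpa using this)

/-- For a primitive even character this sum is a nonzero multiple of `L(1, χ⁻¹)`. -/
theorem sum_mul_log_norm_ne_zero {N : ℕ} [NeZero N] (hN : N ≠ 1) {χ : DirichletCharacter ℂ N}
    (hχ : χ.IsPrimitive) (heven : χ.Even) :
    ∑ j, χ j * (Real.log ‖1 - stdAddChar j‖ : ℂ) ≠ 0 := by
  have hχ0 : χ 0 = 0 := χ.map_zero' hN
  have hχ1 : χ⁻¹ ≠ 1 := by
    rw [ne_eq, inv_eq_one, eq_one_iff_conductor_eq_one, hχ]
    exact hN
  have hg : gaussSum χ stdAddChar ≠ 0 := by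
    intro h
    have h1 : 𝓕 (χ : ZMod N → ℂ) = 0 := by
      ext k
      rw [hχ.fourierTransform_eq_inv_mul_gaussSum, h, mul_zero, Pi.zero_apply]
    have h2 : (χ : ZMod N → ℂ) = 0 := by
      rw [← LinearEquiv.map_eq_zero_iff dft, h1]
    simpa using congrFun h2 1
  have hdft : 𝓕 (χ : ZMod N → ℂ) = fun k ↦ gaussSum χ stdAddChar * χ⁻¹ k := by
    ext k
    have heven' : χ⁻¹.Even := by
      rw [DirichletCharacter.Even, MulChar.inv_apply_eq_inv, heven, Ring.inverse_one]
    rw [hχ.fourierTransform_eq_inv_mul_gaussSum, heven'.eval_neg, mul_comm]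
  have hL : ZMod.LFunction (𝓕 (χ : ZMod N → ℂ)) 1 =
      gaussSum χ stdAddChar * DirichletCharacter.LFunction χ⁻¹ 1 := by
    rw [hdft, DirichletCharacter.LFunction, ZMod.LFunction, ZMod.LFunction]
    simp only [mul_assoc, Finset.mul_sum]
    exact Finset.sum_congr rfl fun j _ ↦ by ring
  have hsum := LFunction_dft (χ : ZMod N → ℂ) (s := 1) (.inl hχ0)
  have hsum' : ∑ j, χ j * HurwitzZeta.expZeta (toAddCircle (-j)) 1 =
      ∑ j, χ j * HurwitzZeta.expZeta (toAddCircle j) 1 := by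
    refine Fintype.sum_equiv (Equiv.neg _) _ _ fun j ↦ ?_
    simp [heven.eval_neg]
  have hlog : 2 * ZMod.LFunction (𝓕 (χ : ZMod N → ℂ)) 1 =
      -2 * ∑ j, χ j * (Real.log ‖1 - stdAddChar j‖ : ℂ) := by
    rw [two_mul]
    nth_rewrite 1 [hsum, hsum']
    rw [hsum, ← Finset.sum_add_distrib, Finset.mul_sum]
    refine Finset.sum_congr rfl fun j _ ↦ ?_
    rcases eq_or_ne j 0 with rfl | hj
    · simp [hχ0]
    · have hconj : 1 - stdAddChar (-j) = starRingEnd ℂ (1 - stdAddChar j) := by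
        rw [map_sub, map_one, AddChar.map_neg_eq_conj]
      rw [expZeta_toAddCircle_one hj, expZeta_toAddCircle_one (neg_ne_zero.2 hj), hconj]
      linear_combination
        (-χ j) * log_add_log_conj _ (one_sub_stdAddChar_mem_slitPlane hj)
  intro h
  rw [h, mul_zero, hL] at hlog
  exact mul_ne_zero two_ne_zero
    (mul_ne_zero hg (LFunction_apply_one_ne_zero hχ1)) hlog

/-- A multiplicative relation between the numbers `ζ ^ a - 1` and all its conjugates forces equality
of even nontrivial primitive character sums. -/
theorem sum_char_inv_eq_of_prod_eq {N : ℕ} [NeZero N] {ι : Type*} [Fintype ι] (hN : N ≠ 1)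
    {χ : DirichletCharacter ℂ N} (hχ : χ.IsPrimitive) (heven : χ.Even) (c d : ι → (ZMod N)ˣ)
    (h : ∀ b : ZMod N, ∏ i, (stdAddChar (b * (c i : ZMod N)) - 1) =
      ∏ i, (stdAddChar (b * (d i : ZMod N)) - 1)) :
    ∑ i, χ⁻¹ (c i) = ∑ i, χ⁻¹ (d i) := by
  set S := ∑ j, χ j * (Real.log ‖1 - stdAddChar j‖ : ℂ) with hS
  have hshift (u : (ZMod N)ˣ) :
      ∑ b, χ b * (Real.log ‖1 - stdAddChar (b * (u : ZMod N))‖ : ℂ) = χ⁻¹ u * S := by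
    symm
    rw [hS, Finset.mul_sum, ← Equiv.sum_comp (Units.mulRight u)]
    refine Finset.sum_congr rfl fun b _ ↦ ?_
    have hu : χ⁻¹ (u : ZMod N) * χ u = 1 := by
      rw [← MulChar.mul_apply, inv_mul_cancel, MulChar.one_apply_coe]
    rw [Units.mulRight_apply, map_mul]
    linear_combination (χ b * (Real.log ‖1 - stdAddChar (b * (u : ZMod N))‖ : ℂ)) * hu
  have hlog (b : ZMod N) (f : ι → (ZMod N)ˣ) (hb : IsUnit b) :
      ∑ i, Real.log ‖1 - stdAddChar (b * (f i : ZMod N))‖ =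
        Real.log ‖∏ i, (stdAddChar (b * (f i : ZMod N)) - 1)‖ := by
    rw [norm_prod, Real.log_prod]
    · simp only [norm_sub_rev]
    · intro i _
      have : Nontrivial (ZMod N) := nontrivial_iff.2 hN
      rw [norm_ne_zero_iff, sub_ne_zero, ← AddChar.map_zero_eq_one (stdAddChar (N := N)), ne_eq,
        injective_stdAddChar.eq_iff]
      exact (hb.mul (f i).isUnit).ne_zero
  have htotal (f : ι → (ZMod N)ˣ) : (∑ i, χ⁻¹ (f i)) * S =
      ∑ b, χ b * ((∑ i, Real.log ‖1 - stdAddChar (b * (f i : ZMod N))‖ : ℝ) : ℂ) := by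
    simp only [Finset.sum_mul, ← hshift, ofReal_sum, Finset.mul_sum]
    exact Finset.sum_comm
  refine mul_right_cancel₀ (sum_mul_log_norm_ne_zero hN hχ heven) ?_
  rw [htotal, htotal]
  refine Finset.sum_congr rfl fun b _ ↦ ?_
  by_cases hb : IsUnit b
  · rw [hlog b c hb, hlog b d hb, h]
  · rw [χ.map_nonunit hb, zero_mul, zero_mul]

theorem sum_char_eq_of_dvd {m : ℕ} [NeZero m] {ι : Type*} [Fintype ι] (c d : ι → ℕ)
    (hc : ∀ i, (c i).Coprime m) (hd : ∀ i, (d i).Coprime m)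
    (hdvd : (Polynomial.X ^ m - 1 : Polynomial ℤ) ∣
      ∏ i, (Polynomial.X ^ c i - 1) - ∏ i, (Polynomial.X ^ d i - 1))
    {χ : DirichletCharacter ℂ m} (heven : χ.Even) :
    ∑ i, χ (c i) = ∑ i, χ (d i) := by
  have hN0 : NeZero χ.conductor := ⟨χ.conductor_ne_zero⟩
  have hNm : χ.conductor ∣ m := χ.conductor_dvd_level
  have happly (a : ℕ) (ha : a.Coprime m) : χ.primitiveCharacter a = χ a := by
    simpa using χ.primitiveCharacter_apply_of_isCoprime (a := a) (by exact_mod_cast ha)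
  by_cases hN : χ.conductor = 1
  · obtain rfl := χ.eq_one_iff_conductor_eq_one.2 hN
    have hone (a : ℕ) (ha : a.Coprime m) : (1 : DirichletCharacter ℂ m) a = 1 :=
      MulChar.one_apply ((isUnit_iff_coprime a m).2 ha)
    simp only [hone _ (hc _), hone _ (hd _)]
  have hprim : χ.primitiveCharacter⁻¹.IsPrimitive := by
    rw [isPrimitive_def, conductor_inv]
    exact χ.primitiveCharacter_isPrimitive
  have heven' : χ.primitiveCharacter⁻¹.Even := by
    have h := χ.primitiveCharacter_apply_of_isCoprime (a := -1) isCoprime_one_left.neg_left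
    push_cast at h
    rw [DirichletCharacter.Even, MulChar.inv_apply_eq_inv, h, heven, Ring.inverse_one]
  have hroot (b : ZMod χ.conductor) (a : ℕ) :
      stdAddChar b ^ a = stdAddChar (b * (a : ZMod χ.conductor)) := by
    rw [← AddChar.map_nsmul_eq_pow, nsmul_eq_mul, mul_comm]
  have h := sum_char_inv_eq_of_prod_eq hN hprim heven'
    (fun i ↦ unitOfCoprime (c i) ((hc i).coprime_dvd_right hNm))
    (fun i ↦ unitOfCoprime (d i) ((hd i).coprime_dvd_right hNm)) fun b ↦ by
      obtain ⟨q, hq⟩ := hdvd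
      have hev := congrArg (Polynomial.aeval (stdAddChar b : ℂ)) hq
      have hm : (m : ZMod χ.conductor) = 0 := (natCast_eq_zero_iff _ _).2 hNm
      simp only [map_sub, map_mul, map_prod, map_pow, Polynomial.aeval_X, map_one, hroot, hm,
        mul_zero, AddChar.map_zero_eq_one, sub_self, zero_mul] at hev
      simpa only [coe_unitOfCoprime] using sub_eq_zero.1 hev
  simpa only [inv_inv, coe_unitOfCoprime, happly _ (hc _), happly _ (hd _)] using h

theorem sum_ite_add_sum_ite_neg_eq {m : ℕ} [NeZero m] {ι : Type*} [Fintype ι]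
    (c d : ι → (ZMod m)ˣ)
    (h : ∀ χ : DirichletCharacter ℂ m, χ.Even → ∑ i, χ (c i) = ∑ i, χ (d i)) (u : (ZMod m)ˣ) :
    ∑ i, ((if u = c i then 1 else 0) + if u = -c i then 1 else 0) =
      ∑ i, ((if u = d i then 1 else 0) + if u = -d i then 1 else 0 : ℕ) := by
  have hsym (χ : DirichletCharacter ℂ m) :
      ∑ i, (χ (c i) + χ (-c i : (ZMod m)ˣ)) = ∑ i, (χ (d i) + χ (-d i : (ZMod m)ˣ)) := by
    rcases χ.even_or_odd with hχ | hχ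
    · simp only [Units.val_neg, hχ.eval_neg, Finset.sum_add_distrib, h χ hχ]
    · simp [hχ.eval_neg]
  have hcount (f : ι → (ZMod m)ˣ) :
      ∑ χ : DirichletCharacter ℂ m, χ (u : ZMod m)⁻¹ *
        ∑ i, (χ (f i) + χ (-f i : (ZMod m)ˣ)) = m.totient *
        ((∑ i, ((if u = f i then 1 else 0) + if u = -f i then 1 else 0) : ℕ) : ℂ) := by
    simp only [Finset.mul_sum, mul_add]
    rw [Finset.sum_comm]
    push_cast
    rw [Finset.mul_sum]
    refine Finset.sum_congr rfl fun i _ ↦ ?_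
    rw [Finset.sum_add_distrib, sum_char_inv_mul_char_eq ℂ u.isUnit,
      sum_char_inv_mul_char_eq ℂ u.isUnit]
    simp only [← Units.val_neg, Units.val_inj, mul_add, mul_ite, mul_one, mul_zero]
  have ht : (m.totient : ℂ) ≠ 0 := by
    exact_mod_cast (Nat.totient_pos.2 (NeZero.pos m)).ne'
  have key := hcount c
  simp only [hsym] at key
  rw [hcount d] at key
  exact_mod_cast (mul_left_cancel₀ ht key).symm

/-- Families that hit every pair `{u, -u}` equally often agree up to a permutation and signs. -/
theorem exists_perm_eq_or_eq_neg {G : Type*} [InvolutiveNeg G] [DecidableEq G]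
    {ι : Type*} [Fintype ι] (c d : ι → G)
    (h : ∀ u, ∑ i, ((if u = c i then 1 else 0) + if u = -c i then 1 else 0) =
      ∑ i, ((if u = d i then 1 else 0) + if u = -d i then 1 else 0 : ℕ)) :
    ∃ σ : Equiv.Perm ι, ∀ i, c i = d (σ i) ∨ c i = -d (σ i) := by
  have hpair (x y : G) : s(x, -x) = s(y, -y) ↔ y = x ∨ y = -x := by
    rw [Sym2.eq_iff]
    grind [neg_neg]
  have hcount (f : ι → G) (u : G) :
      ∑ i, ((if u = f i then 1 else 0) + if u = -f i then 1 else 0) =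
        Fintype.card {i // s(f i, -f i) = s(u, -u)} * if u = -u then 2 else 1 := by
    rw [Fintype.card_subtype, Finset.card_filter, Finset.sum_mul]
    refine Finset.sum_congr rfl fun i _ ↦ ?_
    simp only [hpair]
    grind [neg_neg]
  have hcard (u : G) : Fintype.card {i // s(c i, -c i) = s(u, -u)} =
      Fintype.card {i // s(d i, -d i) = s(u, -u)} := by
    have hu := h u
    rw [hcount, hcount] at hu
    exact Nat.eq_of_mul_eq_mul_right (by split_ifs <;> norm_num) hu
  have hfiber (q : Sym2 G) :
      Nonempty ({i // s(c i, -c i) = q} ≃ {i // s(d i, -d i) = q}) := by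
    rw [← Fintype.card_eq]
    by_cases hq : ∃ u, q = s(u, -u)
    · obtain ⟨u, rfl⟩ := hq
      exact hcard u
    · have hempty (f : ι → G) : IsEmpty {i // s(f i, -f i) = q} :=
        ⟨fun i ↦ hq ⟨_, i.2.symm⟩⟩
      have := hempty c
      have := hempty d
      simp only [Fintype.card_eq_zero]
  refine ⟨Equiv.ofFiberEquiv fun q ↦ (hfiber q).some, fun i ↦ ?_⟩
  exact (hpair _ _).1 (Equiv.ofFiberEquiv_map (fun q ↦ (hfiber q).some) i)

end CyclotomicUnits

open Polynomial

theorem stmt_5 (p t m n : ℕ) (hp : p.Prime) (ht : 1 ≤ t) (hm : m = p ^ t)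
    (c d : Fin n → ℕ)
    (hc : ∀ i, 0 < c i ∧ Nat.Coprime (c i) m)
    (hd : ∀ i, 0 < d i ∧ Nat.Coprime (d i) m)
    (hdvd : ((X : ℤ[X]) ^ m - 1) ∣
      (∏ i, ((X : ℤ[X]) ^ (c i) - 1) - ∏ i, ((X : ℤ[X]) ^ (d i) - 1))) :
    ∃ σ : Equiv.Perm (Fin n), ∀ i,
      c i ≡ d (σ i) [MOD m] ∨ m ∣ (c i + d (σ i)) := by
  have : NeZero m := ⟨by rw [hm]; exact (pow_pos hp.pos t).ne'⟩
  obtain ⟨σ, hσ⟩ := exists_perm_eq_or_eq_neg _ _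
    (sum_ite_add_sum_ite_neg_eq (fun i ↦ ZMod.unitOfCoprime (c i) (hc i).2)
      (fun i ↦ ZMod.unitOfCoprime (d i) (hd i).2) fun χ hχ ↦ by
        simpa only [ZMod.coe_unitOfCoprime] using
          sum_char_eq_of_dvd c d (fun i ↦ (hc i).2) (fun i ↦ (hd i).2) hdvd hχ)
  refine ⟨σ, fun i ↦ (hσ i).imp (fun h ↦ ?_) fun h ↦ ?_⟩
  · rw [← ZMod.natCast_eq_natCast_iff]
    simpa using congrArg Units.val h
  · have h' := congrArg Units.val h
    rw [Units.val_neg, ZMod.coe_unitOfCoprime, ZMod.coe_unitOfCoprime] at h'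
    rw [← ZMod.natCast_eq_zero_iff, Nat.cast_add, h', neg_add_cancel]
end

section
/- Let m > 1 be an integer with m ≢ 2 (mod 4). Let f, g : (ℤ/mℤ)× → ℤ be even functions (f(−h) = f(h) and g(−h) = g(h) for all h) with ∑_{h ∈ (ℤ/mℤ)×} f(h) = ∑_{h ∈ (ℤ/mℤ)×} g(h). In the quotient ring ℚ[X]/(C_m(X)), where C_m(X) = 1 + X + ⋯ + X^{m−1}, the image of X^{h} − 1 is a unit for every h ∈ (ℤ/mℤ)× (h any integer representative coprime to m); if ∏_{h ∈ (ℤ/mℤ)×} (X^{h} − 1)^{f(h)} = ∏_{h ∈ (ℤ/mℤ)×} (X^{h} − 1)^{g(h)} holds in this quotient ring (integer exponents interpreted as powers of these units), then f = g. -/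
open Polynomial

/-- The polynomial `C_m(X) = 1 + X + ⋯ + X^(m-1)` over `ℚ`. -/
noncomputable def Cq (m : ℕ) : ℚ[X] := ∑ i ∈ Finset.range m, X ^ i

/-- The quotient ring `ℚ[X]/(C_m(X))`. -/
abbrev QuotCq (m : ℕ) := ℚ[X] ⧸ Ideal.span {Cq m}

open Filter Topology Finset in
lemma tendsto_sum_by_parts {c : ℕ → ℂ} {B : ℝ} {φ b : ℕ → ℝ}
    (hc : ∀ n, ‖∑ i ∈ range n, c i‖ ≤ B) (hφ : Tendsto φ atTop (𝓝 0)) (hb : Summable b)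
    (hφb : ∀ i, ‖φ i - φ (i + 1)‖ ≤ b i) :
    Tendsto (fun n ↦ ∑ i ∈ range n, φ i • c i) atTop
      (𝓝 (∑' i, (φ i - φ (i + 1)) • ∑ j ∈ range (i + 1), c j)) := by
  have hsum : Summable fun i ↦ (φ i - φ (i + 1)) • ∑ j ∈ range (i + 1), c j := by
    refine Summable.of_norm_bounded (hb.mul_right B) fun i ↦ ?_
    rw [norm_smul]
    exact mul_le_mul (hφb i) (hc _) (norm_nonneg _) ((norm_nonneg _).trans (hφb i))
  rw [← tendsto_add_atTop_iff_nat 1]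
  have hzero : Tendsto (fun n ↦ φ n • ∑ i ∈ range (n + 1), c i) atTop (𝓝 0) :=
    hφ.zero_smul_isBoundedUnder_le
      (isBoundedUnder_of ⟨B, fun n ↦ hc (n + 1)⟩)
  have := hzero.add hsum.hasSum.tendsto_sum_nat
  rw [zero_add] at this
  refine this.congr fun n ↦ ?_
  rw [sum_range_by_parts φ c (n + 1), Nat.add_sub_cancel, sub_eq_add_neg, ← sum_neg_distrib]
  simp only [← neg_smul, neg_sub]

lemma norm_rpow_neg_sub_rpow_neg_le {s : ℝ} (h1 : 1 ≤ s) (h2 : s ≤ 2) (i : ℕ) :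
    ‖((i : ℝ) + 1) ^ (-s) - (((i + 1 : ℕ) : ℝ) + 1) ^ (-s)‖ ≤ 2 * (1 / ((i + 1 : ℕ) : ℝ) ^ 2) := by
  push_cast
  set x : ℝ := (i : ℝ) + 1 with hx
  have hx1 : 1 ≤ x := by simp [hx]
  have hx0 : 0 < x := by linarith
  have hanti : (x + 1) ^ (-s) ≤ x ^ (-s) :=
    Real.rpow_le_rpow_of_nonpos hx0 (by linarith) (by linarith)
  rw [Real.norm_of_nonneg (by linarith)]
  have hq0 : 0 < x / (x + 1) := by positivity
  have hfac : (x + 1) ^ (-s) = x ^ (-s) * (x / (x + 1)) ^ s := by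
    rw [Real.div_rpow hx0.le (by linarith), Real.rpow_neg hx0.le, Real.rpow_neg (by linarith)]
    have := (Real.rpow_pos_of_pos hx0 s).ne'
    field_simp
  have hq : (x / (x + 1)) ^ 2 ≤ (x / (x + 1)) ^ s := by
    rw [← Real.rpow_natCast]
    exact Real.rpow_le_rpow_of_exponent_ge hq0 (by rw [div_le_one] <;> linarith) (by simpa using h2)
  have hxs : x ^ (-s) ≤ x⁻¹ := by
    rw [← Real.rpow_neg_one]
    exact Real.rpow_le_rpow_of_exponent_le hx1 (by linarith)
  have hq' : 1 - (x / (x + 1)) ^ 2 ≤ 2 / x := by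
    rw [div_pow, sub_le_iff_le_add, div_add_div _ _ (by positivity) (by positivity),
      le_div_iff₀ (by positivity)]
    nlinarith
  calc x ^ (-s) - (x + 1) ^ (-s) = x ^ (-s) * (1 - (x / (x + 1)) ^ s) := by rw [hfac]; ring
    _ ≤ x⁻¹ * (2 / x) := by
      refine mul_le_mul hxs (by linarith) ?_ (by positivity)
      rw [sub_nonneg]
      exact Real.rpow_le_one hq0.le (by rw [div_le_one] <;> linarith) (by linarith)
    _ = 2 * (1 / x ^ 2) := by field_simp

open Filter Topology Finset in
lemma tendsto_sum_rpow_neg_smul {c : ℕ → ℂ} {B : ℝ}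
    (hc : ∀ n, ‖∑ i ∈ range n, c i‖ ≤ B) {s : ℝ} (h1 : 1 ≤ s) (h2 : s ≤ 2) :
    Tendsto (fun n ↦ ∑ i ∈ range n, ((i : ℝ) + 1) ^ (-s) • c i) atTop
      (𝓝 (∑' i : ℕ, (((i : ℝ) + 1) ^ (-s) - (((i + 1 : ℕ) : ℝ) + 1) ^ (-s)) •
        ∑ j ∈ range (i + 1), c j)) :=
  tendsto_sum_by_parts (φ := fun i : ℕ ↦ ((i : ℝ) + 1) ^ (-s)) hc
    ((tendsto_rpow_neg_atTop (by linarith)).comp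
      (tendsto_atTop_add_const_right _ _ tendsto_natCast_atTop_atTop))
    (((summable_nat_add_iff 1).2 (Real.summable_one_div_nat_pow.2 one_lt_two)).mul_left 2)
    (norm_rpow_neg_sub_rpow_neg_le h1 h2)

open Filter Topology Finset in
/-- A Dirichlet series whose coefficients have bounded partial sums is right-continuous at `1`. -/
lemma tendsto_sum_inv_smul_of_bounded {c : ℕ → ℂ} {B : ℝ}
    (hc : ∀ n, ‖∑ i ∈ range n, c i‖ ≤ B) {F : ℝ → ℂ} (hF : ContinuousWithinAt F (Set.Ioi 1) 1)
    (hFs : ∀ s, 1 < s → HasSum (fun i : ℕ ↦ ((i : ℝ) + 1) ^ (-s) • c i) (F s)) :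
    Tendsto (fun n ↦ ∑ i ∈ range n, ((i : ℝ) + 1)⁻¹ • c i) atTop (𝓝 (F 1)) := by
  set T : ℝ → ℂ := fun s ↦ ∑' i : ℕ, (((i : ℝ) + 1) ^ (-s) - (((i + 1 : ℕ) : ℝ) + 1) ^ (-s)) •
    ∑ j ∈ range (i + 1), c j
  have hIoc : Set.Ioc (1 : ℝ) 2 ∈ 𝓝[>] 1 := Ioc_mem_nhdsGT one_lt_two
  have hT : Tendsto T (𝓝[>] 1) (𝓝 (T 1)) := by
    refine tendsto_tsum_of_dominated_convergence
      ((((summable_nat_add_iff 1).2 (Real.summable_one_div_nat_pow.2 one_lt_two)).mul_left 2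
        ).mul_right B) (fun i ↦ ?_) ?_
    · refine Tendsto.mono_left (Continuous.tendsto ?_ 1) nhdsWithin_le_nhds
      have h (x : ℝ) (hx : 0 < x) : Continuous fun s : ℝ ↦ x ^ (-s) :=
        (Real.continuous_const_rpow hx.ne').comp continuous_neg
      exact ((h _ (by positivity)).sub (h _ (by positivity))).smul continuous_const
    · filter_upwards [hIoc] with s hs i
      rw [norm_smul]
      exact mul_le_mul (norm_rpow_neg_sub_rpow_neg_le hs.1.le hs.2 i) (hc _) (norm_nonneg _)
        (by positivity)
  have hFT : F 1 = T 1 := by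
    refine tendsto_nhds_unique hF (hT.congr' ?_)
    filter_upwards [hIoc] with s hs
    exact tendsto_nhds_unique (tendsto_sum_rpow_neg_smul hc hs.1.le hs.2)
      (hFs s hs.1).tendsto_sum_nat
  have := tendsto_sum_rpow_neg_smul hc le_rfl one_le_two
  simp only [Real.rpow_neg_one] at this
  rw [hFT]
  convert this using 2
  simp [T, Real.rpow_neg_one]

lemma one_sub_mem_slitPlane {w : ℂ} (hw : ‖w‖ = 1) (hw1 : w ≠ 1) : 1 - w ∈ Complex.slitPlane := by
  refine Or.inl ?_
  rw [Complex.sub_re, Complex.one_re, sub_pos]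
  refine lt_of_le_of_ne (hw ▸ Complex.re_le_norm w) fun h ↦ hw1 ?_
  have := Complex.sq_norm w
  rw [hw, Complex.normSq_apply, h] at this
  exact Complex.ext h (by simpa using this)

open Filter Topology Finset in
/-- The boundary value of the logarithm series. -/
lemma eq_neg_log_of_tendsto {w l : ℂ} (hw : ‖w‖ = 1) (hw1 : w ≠ 1)
    (h : Tendsto (fun n ↦ ∑ i ∈ range n, w ^ i / i) atTop (𝓝 l)) : l = -Complex.log (1 - w) := by
  have habel := Complex.tendsto_tsum_powerSeries_nhdsWithin_lt h
  rw [tendsto_map'_iff] at habel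
  refine tendsto_nhds_unique habel ?_
  have hlog : ContinuousAt (fun x : ℝ ↦ -Complex.log (1 - w * x)) 1 := by
    refine ContinuousAt.neg (ContinuousAt.clog (by fun_prop) ?_)
    simpa using one_sub_mem_slitPlane hw hw1
  have hlim : Tendsto (fun x : ℝ ↦ -Complex.log (1 - w * x)) (𝓝[<] 1)
      (𝓝 (-Complex.log (1 - w))) := by
    simpa using hlog.tendsto.mono_left nhdsWithin_le_nhds
  refine hlim.congr' ?_
  filter_upwards [Ioo_mem_nhdsLT (zero_lt_one (α := ℝ))] with x hx
  have hwx : ‖w * x‖ < 1 := by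
    rw [norm_mul, hw, one_mul, Complex.norm_real, Real.norm_of_nonneg hx.1.le]
    exact hx.2
  rw [← (Complex.hasSum_taylorSeries_neg_log hwx).tsum_eq]
  refine tsum_congr fun n ↦ ?_
  rw [mul_pow, mul_div_right_comm]

open Filter Topology Finset in
lemma expZeta_one_s10 {a : ℝ} (ha : (a : UnitAddCircle) ≠ 0) {w : ℂ}
    (hw : w = Complex.exp (2 * Real.pi * Complex.I * a)) (hw1 : w ≠ 1) :
    HurwitzZeta.expZeta a 1 = -Complex.log (1 - w) := by
  have hnorm : ‖w‖ = 1 := by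
    rw [hw, show (2 * Real.pi * Complex.I * a : ℂ) = ((2 * Real.pi * a : ℝ) : ℂ) * Complex.I by
      push_cast; ring, Complex.norm_exp_ofReal_mul_I]
  refine eq_neg_log_of_tendsto hnorm hw1 ?_
  have hc (n : ℕ) : ‖∑ i ∈ range n, w ^ (i + 1)‖ ≤ 2 / ‖w - 1‖ := by
    simp only [pow_succ, ← sum_mul, norm_mul, hnorm, mul_one]
    rw [geom_sum_eq hw1, norm_div]
    gcongr
    refine (norm_sub_le _ _).trans ?_
    rw [norm_pow, hnorm]
    norm_num
  have := tendsto_sum_inv_smul_of_bounded hc (F := fun s ↦ HurwitzZeta.expZeta a s)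
    ((HurwitzZeta.differentiable_expZeta_of_ne_zero ha).continuous.comp
      Complex.continuous_ofReal).continuousWithinAt (fun s hs ↦ ?_)
  · rw [← tendsto_add_atTop_iff_nat 1]
    refine (Complex.ofReal_one ▸ this).congr fun n ↦ ?_
    rw [sum_range_succ']
    simp only [Nat.cast_zero, div_zero, add_zero]
    refine sum_congr rfl fun i _ ↦ ?_
    rw [Complex.real_smul]
    push_cast
    rw [mul_comm, div_eq_mul_inv]
  · have h := HurwitzZeta.hasSum_expZeta_of_one_lt_re a (s := s) (by simpa using hs)
    rw [← hasSum_nat_add_iff' 1] at h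
    have hs0 : (s : ℂ) ≠ 0 := by
      rw [Ne, Complex.ofReal_eq_zero]
      linarith
    simp only [range_one, sum_singleton, Nat.cast_zero, Complex.zero_cpow hs0, div_zero,
      sub_zero] at h
    refine h.congr_fun fun i ↦ ?_
    rw [Complex.real_smul, Real.rpow_neg (by positivity), hw, ← Complex.exp_nat_mul,
      Complex.ofReal_inv, Complex.ofReal_cpow (by positivity)]
    push_cast
    rw [mul_comm, div_eq_mul_inv, mul_comm (_ * _ : ℂ) ((i : ℂ) + 1)]

lemma stdAddChar_ne_one {d : ℕ} [NeZero d] {j : ZMod d} (hj : j ≠ 0) : ZMod.stdAddChar j ≠ 1 := by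
  rwa [Ne, ← (ZMod.stdAddChar (N := d)).map_zero_eq_one, ZMod.injective_stdAddChar.eq_iff]

lemma expZeta_toAddCircle_one_s10 {d : ℕ} [NeZero d] {j : ZMod d} (hj : j ≠ 0) :
    HurwitzZeta.expZeta (ZMod.toAddCircle j) 1 = -Complex.log (1 - ZMod.stdAddChar j) := by
  have hval : (((j.val / d : ℝ) : ℝ) : UnitAddCircle) = ZMod.toAddCircle j :=
    (ZMod.toAddCircle_apply j).symm
  rw [← hval]
  refine expZeta_one_s10 ?_ ?_ ?_
  · rwa [hval, Ne, ZMod.toAddCircle_eq_zero]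
  · rw [ZMod.stdAddChar_apply, ZMod.toCircle_apply]
    push_cast
    ring_nf
  · exact stdAddChar_ne_one hj

lemma log_add_log_neg {d : ℕ} [NeZero d] {j : ZMod d} (hj : j ≠ 0) :
    Complex.log (1 - ZMod.stdAddChar j) + Complex.log (1 - ZMod.stdAddChar (-j)) =
      2 * (Real.log ‖1 - ZMod.stdAddChar j‖ : ℂ) := by
  have hconj : 1 - ZMod.stdAddChar (-j) = (starRingEnd ℂ) (1 - ZMod.stdAddChar j) := by
    rw [map_sub, map_one, AddChar.map_neg_eq_conj]
  have hnorm : ‖ZMod.stdAddChar j‖ = 1 := by rw [ZMod.stdAddChar_apply, Circle.norm_coe]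
  rw [hconj, Complex.log_conj _ (Complex.slitPlane_arg_ne_pi
      (one_sub_mem_slitPlane hnorm (stdAddChar_ne_one hj))), Complex.add_conj, Complex.log_re]
  push_cast
  rfl

namespace DirichletCharacter

lemma IsPrimitive.gaussSum_stdAddChar_ne_zero {d : ℕ} [NeZero d] {χ : DirichletCharacter ℂ d}
    (hχ : χ.IsPrimitive) : gaussSum χ ZMod.stdAddChar ≠ 0 := by
  intro h
  have hzero : ZMod.dft (χ : ZMod d → ℂ) = 0 := by
    ext k
    rw [hχ.fourierTransform_eq_inv_mul_gaussSum, h, mul_zero, Pi.zero_apply]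
  rw [LinearEquiv.map_eq_zero_iff] at hzero
  simpa using congrFun hzero 1

lemma inv_eval_neg_of_even {d : ℕ} {χ : DirichletCharacter ℂ d} (hχ : χ.Even) (x : ZMod d) :
    χ⁻¹ (-x) = χ⁻¹ x := by
  have : χ⁻¹.Even := by
    rw [DirichletCharacter.Even, MulChar.inv_apply_eq_inv', hχ, inv_one]
  exact DirichletCharacter.Even.eval_neg _ x this

/-- The weighted sum of logarithms of cyclotomic numbers attached to a nontrivial even primitive
character is a nonzero multiple of `L(1, χ⁻¹)`. -/
lemma IsPrimitive.sum_mul_log_ne_zero {d : ℕ} [NeZero d] {χ : DirichletCharacter ℂ d}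
    (hχ : χ.IsPrimitive) (heven : χ.Even) (hne : χ ≠ 1) :
    ∑ j : ZMod d, χ j * (Real.log ‖1 - ZMod.stdAddChar j‖ : ℂ) ≠ 0 := by
  have hd : d ≠ 1 := fun h ↦ hne (level_one' χ h)
  have h0 : χ 0 = 0 := χ.map_zero' hd
  have hdft := ZMod.LFunction_dft (χ : ZMod d → ℂ) (s := 1) (Or.inl h0)
  have hlog : ∑ j : ZMod d, χ j * HurwitzZeta.expZeta (ZMod.toAddCircle (-j)) 1 =
      -∑ j : ZMod d, χ j * (Real.log ‖1 - ZMod.stdAddChar j‖ : ℂ) := by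
    have hflip : ∑ j : ZMod d, χ j * HurwitzZeta.expZeta (ZMod.toAddCircle (-j)) 1 =
        ∑ j : ZMod d, χ j * HurwitzZeta.expZeta (ZMod.toAddCircle j) 1 :=
      Fintype.sum_equiv (Equiv.neg _) _ _ fun j ↦ by rw [Equiv.neg_apply, Even.eval_neg _ _ heven]
    have hadd : ∑ j : ZMod d, χ j * HurwitzZeta.expZeta (ZMod.toAddCircle j) 1 +
        ∑ j : ZMod d, χ j * HurwitzZeta.expZeta (ZMod.toAddCircle (-j)) 1 =
        -(2 * ∑ j : ZMod d, χ j * (Real.log ‖1 - ZMod.stdAddChar j‖ : ℂ)) := by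
      rw [← Finset.sum_add_distrib, Finset.mul_sum, ← Finset.sum_neg_distrib]
      refine Finset.sum_congr rfl fun j _ ↦ ?_
      rcases eq_or_ne j 0 with rfl | hj
      · simp [h0]
      · rw [expZeta_toAddCircle_one_s10 hj, expZeta_toAddCircle_one_s10 (neg_ne_zero.2 hj)]
        linear_combination -(χ j) * log_add_log_neg hj
    rw [← hflip] at hadd
    linear_combination hadd / 2
  have hL : ZMod.LFunction (ZMod.dft (χ : ZMod d → ℂ)) 1 =
      gaussSum χ ZMod.stdAddChar * χ⁻¹.LFunction 1 := by
    rw [LFunction, ZMod.LFunction, ZMod.LFunction, mul_left_comm, Finset.mul_sum _ _ (gaussSum _ _)]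
    congr 1
    refine Finset.sum_congr rfl fun j _ ↦ ?_
    rw [hχ.fourierTransform_eq_inv_mul_gaussSum, inv_eval_neg_of_even heven]
    ring
  intro hzero
  rw [hL, hlog, hzero, neg_zero] at hdft
  exact mul_ne_zero hχ.gaussSum_stdAddChar_ne_zero
    (LFunction_apply_one_ne_zero (inv_ne_one.2 hne)) hdft

/-- If all weighted logarithm sums of level `d` vanish, so does the Fourier coefficient at every
nontrivial even primitive character of level `d`. -/
lemma IsPrimitive.sum_inv_mul_eq_zero {ι : Type*} [Fintype ι] {d : ℕ} [NeZero d]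
    {χ : DirichletCharacter ℂ d} (hχ : χ.IsPrimitive) (heven : χ.Even) (hne : χ ≠ 1)
    (F : ι → ℤ) (r : ι → (ZMod d)ˣ)
    (hF : ∀ a : (ZMod d)ˣ,
      ∑ i, F i * Real.log ‖1 - ZMod.stdAddChar ((a * r i : (ZMod d)ˣ) : ZMod d)‖ = 0) :
    ∑ i, (F i : ℂ) * χ⁻¹ (r i) = 0 := by
  set S : ℂ := ∑ j : ZMod d, χ j * (Real.log ‖1 - ZMod.stdAddChar j‖ : ℂ) with hS
  have hterm (u : (ZMod d)ˣ) :
      χ⁻¹ u * S = ∑ j : ZMod d, χ j * (Real.log ‖1 - ZMod.stdAddChar (j * (u : ZMod d))‖ : ℂ) := by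
    rw [hS, ← Equiv.sum_comp (Units.mulRight u), Finset.mul_sum]
    refine Finset.sum_congr rfl fun j _ ↦ ?_
    have hu : χ⁻¹ u * χ u = 1 := by
      rw [← MulChar.mul_apply, inv_mul_cancel, MulChar.one_apply u.isUnit]
    rw [Units.mulRight_apply, map_mul]
    linear_combination χ j * (Real.log ‖1 - ZMod.stdAddChar (j * (u : ZMod d))‖ : ℂ) * hu
  refine (mul_eq_zero.1 ?_).resolve_right (hχ.sum_mul_log_ne_zero heven hne)
  rw [← hS, Finset.sum_mul]
  simp only [mul_assoc, hterm, Finset.mul_sum]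
  rw [Finset.sum_comm]
  refine Finset.sum_eq_zero fun j _ ↦ ?_
  by_cases hj : IsUnit j
  · obtain ⟨a, rfl⟩ := hj
    have := congrArg (fun x : ℝ ↦ χ a * (x : ℂ)) (hF a)
    simp only [Complex.ofReal_zero, mul_zero] at this
    rw [← this]
    push_cast
    rw [Finset.mul_sum]
    exact Finset.sum_congr rfl fun i _ ↦ by ring
  · simp [χ.map_nonunit hj]

/-- An integer-valued function on `(ZMod m)ˣ` orthogonal to all characters vanishes. -/
lemma eq_zero_of_forall_sum_mul_eq_zero {m : ℕ} [NeZero m] (F : (ZMod m)ˣ → ℤ)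
    (hF : ∀ χ : DirichletCharacter ℂ m, ∑ h, (F h : ℂ) * χ h = 0) : F = 0 := by
  ext a
  have key : ∑ χ : DirichletCharacter ℂ m, χ (a : ZMod m)⁻¹ * ∑ h, (F h : ℂ) * χ h =
      F a * (m.totient : ℂ) := by
    simp only [Finset.mul_sum]
    rw [Finset.sum_comm]
    have (h : (ZMod m)ˣ) : ∑ χ : DirichletCharacter ℂ m, χ (a : ZMod m)⁻¹ * ((F h : ℂ) * χ h) =
        if a = h then F h * (m.totient : ℂ) else 0 := by
      simp only [mul_left_comm _ (F h : ℂ)]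
      rw [← Finset.mul_sum, sum_char_inv_mul_char_eq ℂ a.isUnit, mul_ite, mul_zero]
      simp only [Units.val_inj]
    simp only [this, Finset.sum_ite_eq, Finset.mem_univ, if_true]
  simp only [hF, mul_zero, Finset.sum_const_zero] at key
  have htot : (m.totient : ℂ) ≠ 0 :=
    Nat.cast_ne_zero.2 (Nat.totient_pos.2 (NeZero.pos m)).ne'
  simpa [htot] using key.symm

end DirichletCharacter

lemma eq_zero_of_sum_mul_log_eq_zero {m : ℕ} [NeZero m] (F : (ZMod m)ˣ → ℤ)
    (heven : ∀ h, F (-h) = F h) (hsum : ∑ h, F h = 0)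
    (hlog : ∀ (d : ℕ) [NeZero d] (hd : d ∣ m), d ≠ 1 → ∀ a : (ZMod d)ˣ,
      ∑ h, F h *
        Real.log ‖1 - ZMod.stdAddChar ((a * ZMod.unitsMap hd h : (ZMod d)ˣ) : ZMod d)‖ = 0) :
    F = 0 := by
  refine DirichletCharacter.eq_zero_of_forall_sum_mul_eq_zero F fun χ ↦ ?_
  rcases eq_or_ne χ 1 with rfl | hne
  · simp only [MulChar.one_apply_coe, mul_one]
    exact_mod_cast hsum
  rcases χ.even_or_odd with hχ | hχ
  · have : NeZero χ.conductor := ⟨χ.conductor_ne_zero⟩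
    set ψ := χ.primitiveCharacter with hψ
    have hdvd := χ.conductor_dvd_level
    have hval (h : (ZMod m)ˣ) : ψ (ZMod.unitsMap hdvd h) = χ h := by
      conv_rhs => rw [← χ.changeLevel_primitiveCharacter]
      rw [DirichletCharacter.changeLevel_eq_cast_of_dvd]
      rfl
    have hψeven : ψ.Even := by
      have := hval (-1)
      rwa [Units.val_neg, Units.val_one, hχ, ZMod.unitsMap_def, Units.coe_map, Units.val_neg,
        Units.val_one, MonoidHom.coe_coe, map_neg, map_one] at this
    have hcond : χ.conductor ≠ 1 := fun h ↦ hne (χ.eq_one_iff_conductor_eq_one.2 h)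
    have hψprim : ψ.IsPrimitive := χ.primitiveCharacter_isPrimitive
    have hψne : ψ ≠ 1 := fun h ↦ hne <| by
      rw [← χ.changeLevel_primitiveCharacter, ← hψ, h, map_one]
    have h0 := hψprim.sum_inv_mul_eq_zero hψeven hψne F (ZMod.unitsMap hdvd)
      (hlog _ hdvd hcond)
    have hstar := congrArg (starRingEnd ℂ) h0
    rw [map_sum, map_zero] at hstar
    rw [← hstar]
    refine Finset.sum_congr rfl fun h _ ↦ ?_
    rw [map_mul, ← hval, ← MulChar.star_eq_inv]
    simp
  · refine self_eq_neg.1 ?_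
    rw [← Finset.sum_neg_distrib]
    refine Fintype.sum_equiv (Equiv.neg _) _ _ fun h ↦ ?_
    rw [Equiv.neg_apply, heven, Units.val_neg, DirichletCharacter.Odd.eval_neg _ _ hχ, mul_neg,
      neg_neg]

lemma Cq_mul_X_sub_one (m : ℕ) : Cq m * (X - 1) = X ^ m - 1 :=
  geom_sum_mul X m

lemma isUnit_mk_X_sub_one {m : ℕ} (hm : m ≠ 0) :
    IsUnit (Ideal.Quotient.mk (Ideal.span {Cq m}) (X - 1)) := by
  obtain ⟨q, hq⟩ := X_sub_C_dvd_sub_C_eval (a := (1 : ℚ)) (p := Cq m)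
  have heval : (Cq m).eval 1 = m := by simp [Cq, eval_finsetSum]
  rw [heval, C_1] at hq
  refine isUnit_of_mul_isUnit_left (y := Ideal.Quotient.mk _ (-q)) ?_
  have hmk : Ideal.Quotient.mk (Ideal.span {Cq m}) ((X - 1) * -q) =
      Ideal.Quotient.mk (Ideal.span {Cq m}) (C (m : ℚ)) := by
    rw [Ideal.Quotient.eq, Ideal.mem_span_singleton]
    exact ⟨-1, by linear_combination hq⟩
  rw [← map_mul, hmk]
  exact ((isUnit_C.2 (Nat.cast_ne_zero.2 hm).isUnit)).map _

lemma mk_X_pow_eq_one (m : ℕ) : Ideal.Quotient.mk (Ideal.span {Cq m}) X ^ m = 1 := by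
  rw [← map_pow, ← sub_eq_zero, ← map_one (Ideal.Quotient.mk _), ← map_sub,
    Ideal.Quotient.eq_zero_iff_mem, Ideal.mem_span_singleton]
  exact ⟨X - 1, (Cq_mul_X_sub_one m).symm⟩

lemma isUnit_mk_X_pow_sub_one {m : ℕ} [NeZero m] (h : (ZMod m)ˣ) :
    IsUnit (Ideal.Quotient.mk (Ideal.span {Cq m}) (X ^ (h : ZMod m).val - 1)) := by
  refine isUnit_of_dvd_unit ?_ (isUnit_mk_X_sub_one (NeZero.ne m))
  set x := Ideal.Quotient.mk (Ideal.span {Cq m}) X with hx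
  set k := ((h⁻¹ : (ZMod m)ˣ) : ZMod m).val
  have hmod : (h : ZMod m).val * k ≡ 1 [MOD m] := by
    rw [← ZMod.natCast_eq_natCast_iff]
    simp [k]
  have hpow : x ^ ((h : ZMod m).val * k) = x := by
    conv_rhs => rw [← pow_one x]
    rw [pow_eq_pow_mod _ (mk_X_pow_eq_one m), hmod, ← pow_eq_pow_mod _ (mk_X_pow_eq_one m)]
  have hdvd := sub_dvd_pow_sub_pow (x ^ (h : ZMod m).val) 1 k
  rwa [← pow_mul, hpow, one_pow, hx, ← map_pow, ← map_one (Ideal.Quotient.mk _), ← map_sub,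
    ← map_sub] at hdvd

/-- Evaluation of `QuotCq m` at a nontrivial complex `m`-th root of unity. -/
noncomputable def evalRootOfUnity {m : ℕ} {z : ℂ} (hz : z ^ m = 1) (hz1 : z ≠ 1) :
    QuotCq m →+* ℂ :=
  Ideal.Quotient.lift _ (aeval z : ℚ[X] →ₐ[ℚ] ℂ).toRingHom <| by
    intro p hp
    obtain ⟨q, rfl⟩ := Ideal.mem_span_singleton.1 hp
    have hC : aeval z (Cq m) = 0 := by
      refine (mul_eq_zero.1 ?_).resolve_right (sub_ne_zero.2 hz1)
      simpa [hz] using congrArg (aeval z) (Cq_mul_X_sub_one m)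
    simp [hC]

lemma evalRootOfUnity_mk {m : ℕ} {z : ℂ} (hz : z ^ m = 1) (hz1 : z ≠ 1) (k : ℕ) :
    evalRootOfUnity hz hz1 (Ideal.Quotient.mk _ (X ^ k - 1)) = z ^ k - 1 := by
  simp [evalRootOfUnity]

lemma log_norm_map_prod_zpow {ι R : Type*} [Fintype ι] [CommRing R] (e : R →+* ℂ) (u : ι → Rˣ)
    (F : ι → ℤ) :
    Real.log ‖e ((∏ i, u i ^ F i : Rˣ) : R)‖ = ∑ i, F i * Real.log ‖e (u i)‖ := by
  change Real.log ‖(Units.map (e : R →* ℂ) (∏ i, u i ^ F i) : ℂ)‖ = _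
  simp only [map_prod, map_zpow, Units.coe_prod, Units.val_zpow_eq_zpow_val, Units.coe_map,
    MonoidHom.coe_coe, norm_prod, norm_zpow]
  rw [Real.log_prod fun i _ ↦ zpow_ne_zero _
    (norm_ne_zero_iff.2 ((u i).isUnit.map e).ne_zero)]
  simp only [Real.log_zpow]

lemma stdAddChar_pow_val {m d : ℕ} [NeZero m] [NeZero d] (hd : d ∣ m) (a : (ZMod d)ˣ)
    (h : (ZMod m)ˣ) :
    ZMod.stdAddChar (a : ZMod d) ^ (h : ZMod m).val =
      ZMod.stdAddChar ((a * ZMod.unitsMap hd h : (ZMod d)ˣ) : ZMod d) := by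
  rw [← AddChar.map_nsmul_eq_pow, nsmul_eq_mul, mul_comm, Units.val_mul, ZMod.unitsMap_def,
    Units.coe_map, MonoidHom.coe_coe, ZMod.castHom_apply, ZMod.natCast_val]

theorem stmt_10 (m : ℕ) (hm : 1 < m) (h4 : m % 4 ≠ 2) [NeZero m]
    (f g : (ZMod m)ˣ → ℤ)
    (hf : ∀ h : (ZMod m)ˣ, f (-h) = f h)
    (hg : ∀ h : (ZMod m)ˣ, g (-h) = g h)
    (hsum : ∑ h : (ZMod m)ˣ, f h = ∑ h : (ZMod m)ˣ, g h) :
    (∀ h : (ZMod m)ˣ, IsUnit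
      (Ideal.Quotient.mk (Ideal.span {Cq m}) (X ^ ((h : ZMod m).val) - 1))) ∧
    ∀ u : (ZMod m)ˣ → (QuotCq m)ˣ,
      (∀ h : (ZMod m)ˣ, (u h : QuotCq m) =
          Ideal.Quotient.mk (Ideal.span {Cq m}) (X ^ ((h : ZMod m).val) - 1)) →
      (∏ h : (ZMod m)ˣ, u h ^ f h = ∏ h : (ZMod m)ˣ, u h ^ g h) →
      f = g := by
  refine ⟨isUnit_mk_X_pow_sub_one, fun u hu hprod ↦ ?_⟩
  rw [← sub_eq_zero]
  refine eq_zero_of_sum_mul_log_eq_zero (f - g) (fun h ↦ ?_) ?_ fun d _ hd hd1 a ↦ ?_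
  · rw [Pi.sub_apply, Pi.sub_apply, hf, hg]
  · simp only [Pi.sub_apply, Finset.sum_sub_distrib, hsum, sub_self]
  · have hz : ZMod.stdAddChar (a : ZMod d) ^ m = 1 := by
      rw [← AddChar.map_nsmul_eq_pow, nsmul_eq_mul, (ZMod.natCast_eq_zero_iff m d).2 hd, zero_mul,
        AddChar.map_zero_eq_one]
    have : Fact (1 < d) := ⟨by have := NeZero.pos d; omega⟩
    have hz1 : ZMod.stdAddChar (a : ZMod d) ≠ 1 := stdAddChar_ne_one a.ne_zero
    have hlog := log_norm_map_prod_zpow (evalRootOfUnity hz hz1) u f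
    rw [hprod, log_norm_map_prod_zpow] at hlog
    simp only [hu, evalRootOfUnity_mk, stdAddChar_pow_val hd, norm_sub_rev _ (1 : ℂ)] at hlog
    simp only [Pi.sub_apply, Int.cast_sub, sub_mul, Finset.sum_sub_distrib, hlog, sub_self]
end
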